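/- arXiv:2507.08388 — 3 statements merged into one kernel-verified Lean document; each statement's English description precedes it below -/
import Mathlib

section
/- Let G be a metabelian group which is not periodic (i.e., G contains an element of infinite order) and which has the property K̄∞. Then the commutator subgroup ⁅G,G⁆ of G is finite. -/
/-- A group `G` has property K̄∞ if for every subgroup `X` of `G` the set of
subgroups of the form `⁅X, H⁆`, with `H` ranging over infinite subgroups of `G`,
is finite. -/
def PropKInf (G : Type*) [Group G] : Prop :=
  ∀ X : Subgroup G, {S : Subgroup G | ∃ H : Subgroup G, Infinite H ∧ S = ⁅X, H⁆}.Finite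

section helpers
open scoped commutatorElement

theorem jacobson_int : IsJacobsonRing ℤ := by
  rw [isJacobsonRing_iff_prime_eq]
  intro P hP
  by_cases h : P = ⊥
  · subst h
    rw [eq_bot_iff]
    intro x hx
    rw [Ideal.mem_jacobson_bot] at hx
    have h1 := hx x
    rw [Int.isUnit_iff] at h1
    rw [Ideal.mem_bot]
    rcases h1 with h1 | h1
    · have : x * x = 0 := by linarith
      simpa using this
    · nlinarith [mul_self_nonneg x]
  · have := hP.isMaximal h
    exact Ideal.jacobson_eq_self_of_isMaximal

theorem simple_finite (R : Type*) [CommRing R] [Algebra.FiniteType ℤ R]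
    (M : Type*) [AddCommGroup M] [Module R M] [IsSimpleModule R M] : Finite M := by
  obtain ⟨I, hI, ⟨e⟩⟩ := isSimpleModule_iff_quot_maximal.mp (inferInstance : IsSimpleModule R M)
  let : Field (R ⧸ I) := Ideal.Quotient.field I
  have h1 : Algebra.FiniteType ℤ (R ⧸ I) :=
    Algebra.FiniteType.of_surjective (Ideal.Quotient.mkₐ ℤ I) Ideal.Quotient.mk_surjective
  have := jacobson_int
  have h2 : Module.Finite ℤ (R ⧸ I) := finite_of_finite_type_of_isJacobsonRing ℤ (R ⧸ I)
  have h3 : ∃ n : ℤ, n ≠ 0 ∧ (n : R ⧸ I) = 0 := by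
    by_contra! hcon
    have hinj : Function.Injective (algebraMap ℤ (R ⧸ I)) := by
      rw [injective_iff_map_eq_zero]
      intro n hn
      by_contra hne
      exact hcon n hne (by simpa using hn)
    exact Int.not_isField (isField_of_isIntegral_of_isField hinj (Field.toIsField (R ⧸ I)))
  obtain ⟨n, hn, hn0⟩ := h3
  have h4 : Module.IsTorsion ℤ (R ⧸ I) := by
    intro x
    refine ⟨⟨n, mem_nonZeroDivisors_of_ne_zero hn⟩, ?_⟩
    change n • x = 0
    rw [zsmul_eq_mul, hn0, zero_mul]
  have := Module.finite_of_fg_torsion (R ⧸ I) h4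
  exact Finite.of_equiv _ e.symm.toEquiv

theorem finLen_finite (R : Type*) [CommRing R] [Algebra.FiniteType ℤ R]
    (M : Type*) [AddCommGroup M] [Module R M] (h : IsFiniteLength R M) : Finite M := by
  induction h with
  | of_subsingleton => infer_instance
  | @of_simple_quotient M _ _ N _ _ ih =>
    have := simple_finite R (M ⧸ N)
    have e := (AddSubgroup.addGroupEquivQuotientProdAddSubgroup (s := N.toAddSubgroup))
    have : Finite (M ⧸ N.toAddSubgroup) := this
    have : Finite N.toAddSubgroup := ih
    exact Finite.of_equiv _ e.symm

theorem finSub_finite (R : Type*) [CommRing R] [Algebra.FiniteType ℤ R]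
    (M : Type*) [AddCommGroup M] [Module R M] [Finite (Submodule R M)] : Finite M :=
  finLen_finite R M (isFiniteLength_iff_isNoetherian_isArtinian.mpr
    ⟨isNoetherian_iff'.mpr inferInstance, inferInstance⟩)

theorem finiteType_int_irrel (R : Type*) [CommRing R] (i : Algebra ℤ R)
    (h : @Algebra.FiniteType ℤ R _ _ i) : @Algebra.FiniteType ℤ R _ _ (Ring.toIntAlgebra R) := by
  have : i = Ring.toIntAlgebra R := Subsingleton.elim _ _
  rwa [this] at h

theorem key0 (V : Type*) [CommGroup V] (φ : MulAut V)
    (h : {S : Subgroup V | ∀ s ∈ S, φ s ∈ S ∧ φ⁻¹ s ∈ S}.Finite) : Finite V := by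
  let : MulDistribMulAction (Multiplicative ℤ) V :=
    MulDistribMulAction.compHom V (zpowersHom (MulAut V) φ)
  let ρ := Representation.ofMulDistribMulAction (Multiplicative ℤ) V
  have hsm : ∀ v : V, ρ (Multiplicative.ofAdd 1) (Additive.ofMul v) = Additive.ofMul (φ v) := by
    intro v
    change Additive.ofMul ((zpowersHom (MulAut V) φ (Multiplicative.ofAdd 1)) v) = _
    simp
  have hsm' : ∀ v : V, ρ (Multiplicative.ofAdd (-1)) (Additive.ofMul v) =
      Additive.ofMul (φ⁻¹ v) := by
    intro v
    change Additive.ofMul ((zpowersHom (MulAut V) φ (Multiplicative.ofAdd (-1))) v) = _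
    simp
  let F : Submodule (MonoidAlgebra ℤ (Multiplicative ℤ)) ρ.asModule →
      {S : Subgroup V | ∀ s ∈ S, φ s ∈ S ∧ φ⁻¹ s ∈ S} := fun N =>
    ⟨{ carrier := {v | ρ.asModuleEquiv.symm (Additive.ofMul v) ∈ N}
       mul_mem' := by
        intro a b ha hb
        simp only [Set.mem_ofPred_eq, ofMul_mul, map_add] at *
        exact N.add_mem ha hb
       one_mem' := by simp
       inv_mem' := by
        intro a ha
        simp only [Set.mem_ofPred_eq, ofMul_inv, map_neg] at *
        exact N.neg_mem ha }, by
      intro s hs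
      change ρ.asModuleEquiv.symm (Additive.ofMul (φ s)) ∈ N ∧
        ρ.asModuleEquiv.symm (Additive.ofMul (φ⁻¹ s)) ∈ N
      rw [← hsm, ← hsm', Representation.asModuleEquiv_symm_map_rho,
        Representation.asModuleEquiv_symm_map_rho]
      exact ⟨N.smul_mem _ hs, N.smul_mem _ hs⟩⟩
  have hF : Function.Injective F := by
    intro N N' hNN
    ext x
    have := congrArg (fun S => (ρ.asModuleEquiv x).toMul ∈ S.1) hNN
    have h2 : (ρ.asModuleEquiv.symm (Additive.ofMul (ρ.asModuleEquiv x).toMul) ∈ N) =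
      (ρ.asModuleEquiv.symm (Additive.ofMul (ρ.asModuleEquiv x).toMul) ∈ N') := this
    simpa using h2
  have := h.to_subtype
  have : Finite (Submodule (MonoidAlgebra ℤ (Multiplicative ℤ)) ρ.asModule) :=
    Finite.of_injective F hF
  have hfg : Monoid.FG (Multiplicative ℤ) := AddMonoid.fg_iff_mul_fg.mp inferInstance
  have h6 : @Algebra.FiniteType ℤ (MonoidAlgebra ℤ (Multiplicative ℤ)) _ _ MonoidAlgebra.algebra :=
    MonoidAlgebra.finiteType_of_fg
  have h7 := finiteType_int_irrel (MonoidAlgebra ℤ (Multiplicative ℤ)) MonoidAlgebra.algebra h6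
  have h5 := finSub_finite (MonoidAlgebra ℤ (Multiplicative ℤ)) ρ.asModule
  exact Finite.of_equiv ρ.asModule (ρ.asModuleEquiv.toEquiv.trans Additive.toMul)

/-- `x` normalizes `S`. -/
def Nz {G : Type*} [Group G] (S : Subgroup G) (x : G) : Prop :=
  ∀ s ∈ S, x * s * x⁻¹ ∈ S ∧ x⁻¹ * s * x ∈ S

theorem Nz.mul {G : Type*} [Group G] {S : Subgroup G} {x y : G} (hx : Nz S x) (hy : Nz S y) :
    Nz S (x * y) := by
  intro s hs
  have h1 := (hx _ (hy s hs).1).1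
  have h2 := (hy _ (hx s hs).2).2
  constructor
  · convert h1 using 1; group
  · convert h2 using 1; group

theorem Nz.inv {G : Type*} [Group G] {S : Subgroup G} {x : G} (hx : Nz S x) : Nz S x⁻¹ := by
  intro s hs
  refine ⟨?_, ?_⟩
  · simpa using (hx s hs).2
  · simpa using (hx s hs).1

theorem Nz.one {G : Type*} [Group G] {S : Subgroup G} : Nz S (1 : G) := by
  intro s hs
  simpa using hs

theorem Nz.closure {G : Type*} [Group G] {S : Subgroup G} {t : Set G} (ht : ∀ x ∈ t, Nz S x) :
    ∀ x ∈ Subgroup.closure t, Nz S x := by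
  intro x hx
  induction hx using Subgroup.closure_induction with
  | mem x hx => exact ht x hx
  | one => exact Nz.one
  | mul x y _ _ h1 h2 => exact h1.mul h2
  | inv x _ h => exact h.inv

theorem comm_closure_le {G : Type*} [Group G] {S : Subgroup G} {s t : Set G}
    (hs : ∀ x ∈ s, Nz S x) (ht : ∀ x ∈ t, Nz S x) (hst : ∀ x ∈ s, ∀ y ∈ t, ⁅x, y⁆ ∈ S) :
    ⁅Subgroup.closure s, Subgroup.closure t⁆ ≤ S := by
  rw [Subgroup.commutator_le]
  intro x hx y hy
  have h1 : ∀ x ∈ s, ⁅x, y⁆ ∈ S := by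
    intro x hx
    induction hy using Subgroup.closure_induction with
    | mem y hy => exact hst x hx y hy
    | one => simp
    | mul y z hy hz h1 h2 =>
      have := S.mul_mem h1 (Nz.closure ht y hy _ h2).1
      convert this using 1
      simp only [commutatorElement_def]; group
    | inv y hy h =>
      have := (Nz.closure ht y hy _ (S.inv_mem h)).2
      convert this using 1
      simp only [commutatorElement_def]; group
  clear hst
  induction hx using Subgroup.closure_induction with
  | mem x hx => exact h1 x hx
  | one => simp
  | mul x z hx hz h2 h3 =>
    have := S.mul_mem (Nz.closure hs x hx _ h3).1 h2
    convert this using 1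
    simp only [commutatorElement_def]; group
  | inv x hx h =>
    have := (Nz.closure hs x hx _ (S.inv_mem h)).2
    convert this using 1
    simp only [commutatorElement_def]; group

section main
variable {G : Type*} [Group G]

theorem comm_mem (x y : G) : ⁅x, y⁆ ∈ commutator G :=
  Subgroup.commutator_mem_commutator (Subgroup.mem_top x) (Subgroup.mem_top y)

theorem hA_of (hmeta : (⁅commutator G, commutator G⁆ : Subgroup G) = ⊥) :
    ∀ a ∈ commutator G, ∀ b ∈ commutator G, a * b = b * a := by
  intro a ha b hb
  have h : ⁅a, b⁆ ∈ (⁅commutator G, commutator G⁆ : Subgroup G) :=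
    Subgroup.commutator_mem_commutator ha hb
  rw [hmeta, Subgroup.mem_bot] at h
  exact commutatorElement_eq_one_iff_mul_comm.mp h

theorem conj_mem {a : G} (x : G) (ha : a ∈ commutator G) : x * a * x⁻¹ ∈ commutator G :=
  (inferInstance : (commutator G).Normal).conj_mem a ha x

theorem conj_fix (hA : ∀ a ∈ commutator G, ∀ b ∈ commutator G, a * b = b * a)
    {a b : G} (ha : a ∈ commutator G) (hb : b ∈ commutator G) : a * b * a⁻¹ = b := by
  rw [hA a ha b hb]; group

theorem comm_mul_left (x y z : G) : ⁅x * y, z⁆ = x * ⁅y, z⁆ * x⁻¹ * ⁅x, z⁆ := by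
  simp only [commutatorElement_def]; group

theorem comm_mul_right (x y z : G) : ⁅x, y * z⁆ = ⁅x, y⁆ * (y * ⁅x, z⁆ * y⁻¹) := by
  simp only [commutatorElement_def]; group

/-- the subgroup `[g, G']`. -/
def VA (hA : ∀ a ∈ commutator G, ∀ b ∈ commutator G, a * b = b * a) (g : G) : Subgroup G where
  carrier := {z | ∃ a ∈ commutator G, z = ⁅g, a⁆}
  one_mem' := ⟨1, Subgroup.one_mem _, by simp⟩
  mul_mem' := by
    rintro _ _ ⟨a, ha, rfl⟩ ⟨b, hb, rfl⟩
    refine ⟨a * b, Subgroup.mul_mem _ ha hb, ?_⟩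
    rw [comm_mul_right, conj_fix hA ha (comm_mem _ _)]
  inv_mem' := by
    rintro _ ⟨a, ha, rfl⟩
    refine ⟨a⁻¹, Subgroup.inv_mem _ ha, ?_⟩
    have : ⁅g, a⁻¹⁆ = a⁻¹ * ⁅g, a⁆⁻¹ * a⁻¹⁻¹ := by
      simp only [commutatorElement_def]; group
    rw [this, conj_fix hA (Subgroup.inv_mem _ ha) (Subgroup.inv_mem _ (comm_mem _ _))]

theorem VA_le (hA : ∀ a ∈ commutator G, ∀ b ∈ commutator G, a * b = b * a) (g : G) :
    VA hA g ≤ commutator G := by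
  rintro _ ⟨a, ha, rfl⟩
  exact comm_mem _ _

theorem VA_normal (hA : ∀ a ∈ commutator G, ∀ b ∈ commutator G, a * b = b * a) (g : G) :
    (VA hA g).Normal := by
  constructor
  rintro _ ⟨a, ha, rfl⟩ x
  refine ⟨x * a * x⁻¹, conj_mem x ha, ?_⟩
  have h1 : x * ⁅g, a⁆ * x⁻¹ = ⁅g * ⁅g⁻¹, x⁆, x * a * x⁻¹⁆ := by
    simp only [commutatorElement_def]; group
  have h2 : ⁅⁅g⁻¹, x⁆, x * a * x⁻¹⁆ = 1 :=
    commutatorElement_eq_one_iff_mul_comm.mpr (hA _ (comm_mem _ _) _ (conj_mem x ha))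
  rw [h1, comm_mul_left, h2]; simp

theorem inf_closure {g : G} (hg : ¬IsOfFinOrder g) {s : Set G} (hs : g ∈ s) :
    Infinite (Subgroup.closure s) := by
  have h1 : Infinite (Subgroup.zpowers g) := by
    rw [← not_finite_iff_infinite]
    intro h
    exact hg (finite_zpowers.mp (Set.toFinite _))
  have h2 : Subgroup.zpowers g ≤ Subgroup.closure s := by
    rw [Subgroup.zpowers_le]
    exact Subgroup.subset_closure hs
  exact Infinite.of_injective _ (Subgroup.inclusion_injective h2)

theorem VA_finite (hA : ∀ a ∈ commutator G, ∀ b ∈ commutator G, a * b = b * a)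
    (hG : PropKInf G) {g : G} (hg : ¬IsOfFinOrder g) : Finite (VA hA g) := by
  have hVn := VA_normal hA g
  let i : CommGroup (VA hA g) :=
    { (inferInstance : Group (VA hA g)) with
      mul_comm := by
        rintro ⟨a, ha⟩ ⟨b, hb⟩
        exact Subtype.ext (hA a (VA_le hA g ha) b (VA_le hA g hb)) }
  refine key0 (VA hA g) (MulAut.conjNormal g) ?_
  refine Set.Finite.of_injOn (f := fun S => S.map (VA hA g).subtype) ?_ ?_
    (hG (Subgroup.closure {g}))
  · intro S hS
    set T := S.map (VA hA g).subtype with hT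
    have hTV : T ≤ VA hA g := Subgroup.map_subtype_le S
    refine ⟨Subgroup.closure ({g} ∪ {a | a ∈ commutator G ∧ ⁅g, a⁆ ∈ T}),
      inf_closure hg (Or.inl rfl), ?_⟩
    have hgT : Nz T g := by
      rintro _ ⟨s, hs, rfl⟩
      have := hS s hs
      refine ⟨⟨_, this.1, ?_⟩, ⟨_, this.2, ?_⟩⟩
      · exact MulAut.conjNormal_apply g s
      · exact MulAut.conjNormal_inv_apply g s
    apply le_antisymm
    · intro z hz
      obtain ⟨a, ha, rfl⟩ := hTV hz
      exact Subgroup.commutator_mem_commutator (Subgroup.subset_closure rfl)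
        (Subgroup.subset_closure (Or.inr ⟨ha, hz⟩))
    · apply comm_closure_le
      · rintro x rfl
        exact hgT
      · rintro x (rfl | ⟨hx, -⟩)
        · exact hgT
        · intro s hs
          have hs' := VA_le hA g (hTV hs)
          refine ⟨by rwa [conj_fix hA hx hs'], ?_⟩
          have := conj_fix hA (Subgroup.inv_mem _ hx) hs'
          rw [inv_inv] at this
          rwa [this]
      · rintro x rfl y (rfl | ⟨-, hy⟩)
        · simp
        · exact hy
  · intro S _ S' _ h
    exact Subgroup.map_injective (VA hA g).subtype_injective h


theorem fin_comm_mul {K : Set G} {x y : G} (hx : {z | ∃ k ∈ K, z = ⁅x, k⁆}.Finite)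
    (hy : {z | ∃ k ∈ K, z = ⁅y, k⁆}.Finite) : {z | ∃ k ∈ K, z = ⁅x * y, k⁆}.Finite := by
  refine (Set.Finite.image2 (fun u v => x * v * x⁻¹ * u) hx hy).subset ?_
  rintro _ ⟨k, hk, rfl⟩
  exact ⟨_, ⟨k, hk, rfl⟩, _, ⟨k, hk, rfl⟩, (comm_mul_left x y k).symm⟩

theorem div_torsion (B : Type*) [CommGroup B] [Group.FG B] (c : B)
    (h : ∀ j : ℕ, ∃ β : B, c = β ^ (2 ^ j)) : IsOfFinOrder c := by
  have : Module.Finite ℤ (Additive B) := Module.Finite.iff_addGroup_fg.mpr inferInstance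
  have h1 : Additive.ofMul c ∈
      (⨅ i : ℕ, (Ideal.span {(2 : ℤ)}) ^ i • ⊤ : Submodule ℤ (Additive B)) := by
    rw [Submodule.mem_iInf]
    intro j
    obtain ⟨β, hβ⟩ := h j
    have : Additive.ofMul c = ((2 : ℤ) ^ j) • Additive.ofMul β := by
      rw [hβ, ofMul_pow, ← natCast_zsmul]
      push_cast
      rfl
    rw [this]
    exact Submodule.smul_mem_smul (Ideal.pow_mem_pow (Ideal.mem_span_singleton_self 2) j)
      Submodule.mem_top
  rw [Ideal.mem_iInf_smul_pow_eq_bot_iff] at h1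
  obtain ⟨⟨r, hr⟩, hrc⟩ := h1
  rw [Ideal.mem_span_singleton] at hr
  have h2 : c ^ r = c := hrc
  rw [isOfFinOrder_iff_zpow_eq_one]
  refine ⟨r - 1, by omega, ?_⟩
  rw [zpow_sub, h2]; simp

theorem div_torsion_sub (B : Subgroup G) [Group.FG B] (hB : ∀ u ∈ B, ∀ v ∈ B, u * v = v * u) (c : G)
    (h : ∀ j : ℕ, ∃ β ∈ B, c = β ^ (2 ^ j)) : IsOfFinOrder c := by
  have hcB : c ∈ B := by
    obtain ⟨β, hβ, hβe⟩ := h 0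
    rw [hβe]
    exact B.pow_mem hβ _
  let ci : CommGroup B :=
    { (inferInstance : Group B) with
      mul_comm := by
        rintro ⟨u, hu⟩ ⟨v, hv⟩
        exact Subtype.ext (hB u hu v hv) }
  have htor : IsOfFinOrder (⟨c, hcB⟩ : B) := by
    refine div_torsion B _ ?_
    intro j
    obtain ⟨β, hβ, hβe⟩ := h j
    exact ⟨⟨β, hβ⟩, Subtype.ext hβe⟩
  exact B.subtype.isOfFinOrder htor

theorem pigeon {α : Type*} {s : Set α} (hs : s.Finite) (f : ℕ → α) (hf : ∀ j, f j ∈ s) :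
    ∃ i, ∀ j, ∃ k > j, f k = f i := by
  have := hs.to_subtype
  obtain ⟨U, hUi⟩ := Finite.exists_infinite_fiber (fun j => (⟨f j, hf j⟩ : s))
  have hJ := Set.infinite_coe_iff.mp hUi
  obtain ⟨i, hi⟩ := hJ.nonempty
  refine ⟨i, fun j => ?_⟩
  obtain ⟨k, hk, hjk⟩ := hJ.exists_gt j
  exact ⟨k, hjk, congrArg Subtype.val (hk.trans hi.symm)⟩

theorem comm_pow_right (hA : ∀ a ∈ commutator G, ∀ b ∈ commutator G, a * b = b * a)
    (x : G) {b : G} (hb : b ∈ commutator G) (m : ℕ) : ⁅x, b ^ m⁆ = ⁅x, b⁆ ^ m := by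
  induction m with
  | zero => simp
  | succ m ih =>
    rw [pow_succ, comm_mul_right, ih, conj_fix hA (Subgroup.pow_mem _ hb m) (comm_mem _ _),
      pow_succ]

theorem commuting_power (hA : ∀ a ∈ commutator G, ∀ b ∈ commutator G, a * b = b * a)
    (hG : PropKInf G) {x b : G} (hx : IsOfFinOrder x) (hb : b ∈ commutator G)
    (hbi : ¬IsOfFinOrder b) : ∃ N : ℕ, 0 < N ∧ ⁅x, b ^ N⁆ = 1 := by
  let E : Set G := Set.image (fun y => y * b * y⁻¹) (Subgroup.zpowers x : Set G)
  have hE : E.Finite := Set.Finite.image _ (finite_zpowers.mpr hx)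
  let B : Subgroup G := Subgroup.closure E
  have hBA : B ≤ commutator G := by
    rw [Subgroup.closure_le]
    rintro _ ⟨y, -, rfl⟩
    exact conj_mem y hb
  have hfg : Group.FG B := by
    rw [Group.fg_iff_subgroup_fg]
    exact (Subgroup.fg_iff B).mpr ⟨E, rfl, hE⟩
  have hxB : ∀ y ∈ Subgroup.zpowers x, ∀ β ∈ B, y * β * y⁻¹ ∈ B := by
    intro y hy β hβ
    induction hβ using Subgroup.closure_induction with
    | mem z hz =>
      obtain ⟨w, hw, rfl⟩ := hz
      refine Subgroup.subset_closure ⟨y * w, Subgroup.mul_mem _ hy hw, ?_⟩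
      simp only; group
    | one => simp
    | mul u v _ _ hu hv =>
      have := B.mul_mem hu hv
      convert this using 1; group
    | inv u _ hu =>
      have := B.inv_mem hu
      convert this using 1; group
  have hbB : b ∈ B := Subgroup.subset_closure ⟨1, Subgroup.one_mem _, by simp⟩
  obtain ⟨P, hP⟩ : ∃ P : ℕ → Subgroup G, ∀ m z, z ∈ P m ↔ ∃ β ∈ B, z = β ^ m := ⟨fun m =>
    { carrier := {z | ∃ β ∈ B, z = β ^ m}
      one_mem' := ⟨1, B.one_mem, by simp⟩
      mul_mem' := by
        rintro _ _ ⟨u, hu, rfl⟩ ⟨v, hv, rfl⟩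
        exact ⟨u * v, B.mul_mem hu hv,
          (Commute.mul_pow (hA u (hBA hu) v (hBA hv)) m).symm⟩
      inv_mem' := by
        rintro _ ⟨u, hu, rfl⟩
        exact ⟨u⁻¹, B.inv_mem hu, (inv_pow u m).symm⟩ }, fun m z => Iff.rfl⟩
  have hU : ∀ m, ⁅Subgroup.closure {x}, Subgroup.closure {b ^ m}⁆ ≤ P m := by
    intro m
    have hx' : x ∈ Subgroup.zpowers x := Subgroup.mem_zpowers x
    apply comm_closure_le
    · rintro y rfl s hs
      obtain ⟨β, hβ, rfl⟩ := (hP m s).mp hs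
      refine ⟨(hP m _).mpr ⟨_, hxB _ hx' β hβ, conj_pow.symm⟩,
        (hP m _).mpr ⟨_, hxB _ (Subgroup.inv_mem _ hx') β hβ, ?_⟩⟩
      rw [conj_pow]; simp
    · rintro y rfl s hs
      obtain ⟨β, hβ, rfl⟩ := (hP m s).mp hs
      have e1 := conj_fix hA (Subgroup.pow_mem _ hb m) (Subgroup.pow_mem _ (hBA hβ) m)
      have e2 := conj_fix hA (Subgroup.inv_mem _ (Subgroup.pow_mem _ hb m))
        (Subgroup.pow_mem _ (hBA hβ) m)
      rw [inv_inv] at e2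
      rw [e1, e2]
      exact ⟨hs, hs⟩
    · rintro y rfl z rfl
      rw [comm_pow_right hA _ hb]
      refine (hP m _).mpr ⟨_, ?_, rfl⟩
      rw [commutatorElement_def]
      exact B.mul_mem (hxB _ hx' b hbB) (B.inv_mem hbB)
  have hbm : ∀ j : ℕ, ¬IsOfFinOrder (b ^ (2 ^ j)) := by
    intro j h
    exact hbi (h.of_pow (by positivity))
  obtain ⟨i, hi⟩ := pigeon (hG (Subgroup.closure {x}))
    (fun j => ⁅Subgroup.closure {x}, Subgroup.closure {b ^ (2 ^ j)}⁆)
    (fun j => ⟨Subgroup.closure {b ^ (2 ^ j)}, inf_closure (hbm j) (Set.mem_singleton _), rfl⟩)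
  have hc : ∀ j, ⁅x, b⁆ ^ (2 ^ i) ∈ P (2 ^ j) := by
    intro j
    obtain ⟨k, hjk, hk⟩ := hi j
    have h1 : ⁅x, b ^ (2 ^ i)⁆ ∈ ⁅Subgroup.closure {x}, Subgroup.closure {b ^ (2 ^ i)}⁆ :=
      Subgroup.commutator_mem_commutator (Subgroup.subset_closure rfl)
        (Subgroup.subset_closure rfl)
    rw [← hk, comm_pow_right hA _ hb] at h1
    obtain ⟨β, hβ, hβe⟩ := (hP _ _).mp (hU _ h1)
    refine (hP _ _).mpr ⟨β ^ (2 ^ (k - j)), B.pow_mem hβ _, ?_⟩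
    rw [hβe, ← pow_mul, ← pow_add]
    congr 2
    omega
  have htor2 : IsOfFinOrder (⁅x, b⁆ ^ (2 ^ i)) :=
    div_torsion_sub B (fun u hu v hv => hA u (hBA hu) v (hBA hv)) _
      (fun j => (hP _ _).mp (hc j))
  have htor3 : IsOfFinOrder ⁅x, b⁆ := htor2.of_pow (by positivity)
  obtain ⟨N, hN, hN1⟩ := isOfFinOrder_iff_pow_eq_one.mp htor3
  exact ⟨N, hN, by rw [comm_pow_right hA _ hb, hN1]⟩

theorem quot_comm (x y : G) :
    (QuotientGroup.mk' (commutator G)) x * (QuotientGroup.mk' (commutator G)) y =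
    (QuotientGroup.mk' (commutator G)) y * (QuotientGroup.mk' (commutator G)) x := by
  rw [← commutatorElement_eq_one_iff_mul_comm, ← map_commutatorElement]
  exact (QuotientGroup.eq_one_iff _).mpr (comm_mem _ _)

theorem exists_inf_factor (hA : ∀ a ∈ commutator G, ∀ b ∈ commutator G, a * b = b * a)
    (hnp : ∃ g : G, ¬IsOfFinOrder g) (hG : PropKInf G) (x : G) :
    ∃ g h : G, ¬IsOfFinOrder g ∧ ¬IsOfFinOrder h ∧ x = g * h := by
  by_cases hx : IsOfFinOrder x
  swap
  · refine ⟨x ^ 2, x⁻¹, fun h => hx (h.of_pow two_ne_zero), fun h => hx ?_, by group⟩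
    simpa using h.inv
  suffices h : ∃ g : G, ¬IsOfFinOrder g ∧ ¬IsOfFinOrder (x * g) by
    obtain ⟨g, hg, hxg⟩ := h
    refine ⟨x * g, g⁻¹, hxg, fun h => hg ?_, by group⟩
    simpa using h.inv
  by_cases ht : ∃ b ∈ commutator G, ¬IsOfFinOrder b
  · obtain ⟨b, hb, hbi⟩ := ht
    obtain ⟨N, hN, hxN⟩ := commuting_power hA hG hx hb hbi
    have hbN : ¬IsOfFinOrder (b ^ N) := fun h => hbi (h.of_pow hN.ne')
    refine ⟨b ^ N, hbN, fun h => hbN ?_⟩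
    have hc : Commute x (b ^ N) := commutatorElement_eq_one_iff_mul_comm.mp hxN
    have h2 : Commute x⁻¹ (x * b ^ N) := ((Commute.refl x).mul_right hc).inv_left
    have := h2.isOfFinOrder_mul hx.inv h
    simpa using this
  · push Not at ht
    obtain ⟨g, hg⟩ := hnp
    refine ⟨g, hg, fun h => hg ?_⟩
    let π := QuotientGroup.mk' (commutator G)
    have h1 : IsOfFinOrder (π (x * g)) := π.isOfFinOrder h
    have h2 : IsOfFinOrder (π x⁻¹) := π.isOfFinOrder hx.inv
    have h3 : Commute (π x⁻¹) (π (x * g)) := quot_comm _ _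
    have h4 := h3.isOfFinOrder_mul h2 h1
    rw [← map_mul, inv_mul_cancel_left] at h4
    obtain ⟨n, hn, hn1⟩ := isOfFinOrder_iff_pow_eq_one.mp h4
    rw [← map_pow] at hn1
    have h5 : g ^ n ∈ commutator G := (QuotientGroup.eq_one_iff _).mp hn1
    exact (ht _ h5).of_pow hn.ne'

theorem VA_finite_all (hA : ∀ a ∈ commutator G, ∀ b ∈ commutator G, a * b = b * a)
    (hnp : ∃ g : G, ¬IsOfFinOrder g) (hG : PropKInf G) (x : G) : Finite (VA hA x) := by
  obtain ⟨g, h, hg, hh, rfl⟩ := exists_inf_factor hA hnp hG x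
  have h1 := VA_finite hA hG hg
  have h2 := VA_finite hA hG hh
  exact Set.finite_coe_iff.mpr (fin_comm_mul (K := (commutator G : Set G))
    (Set.finite_coe_iff.mp h1) (Set.finite_coe_iff.mp h2))

theorem comm_pow_central {Q : Type*} [Group Q] {g y : Q} (hy : Commute y ⁅g, y⁆) (n : ℕ) :
    ⁅g, y ^ n⁆ = ⁅g, y⁆ ^ n := by
  induction n with
  | zero => simp
  | succ n ih =>
    have h1 : y ^ n * ⁅g, y⁆ * (y ^ n)⁻¹ = ⁅g, y⁆ := by
      rw [(hy.pow_left n).eq]; group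
    rw [pow_succ, comm_mul_right, ih, h1, pow_succ]

theorem comm_le_zpowers {Q : Type*} [Group Q] {g y : Q} (hg : Commute g ⁅g, y⁆)
    (hy : Commute y ⁅g, y⁆) (n : ℕ) :
    ⁅Subgroup.closure {g}, Subgroup.closure {g, y ^ n}⁆ ≤ Subgroup.zpowers (⁅g, y⁆ ^ n) := by
  have key : ∀ z : Q, Commute z ⁅g, y⁆ → Nz (Subgroup.zpowers (⁅g, y⁆ ^ n)) z := by
    intro z hz s hs
    obtain ⟨k, rfl⟩ := Subgroup.mem_zpowers_iff.mp hs
    have h1 : Commute z ((⁅g, y⁆ ^ n) ^ k) := (hz.pow_right n).zpow_right k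
    have h2 : Commute z⁻¹ ((⁅g, y⁆ ^ n) ^ k) := h1.inv_left
    constructor
    · rw [h1.eq, mul_inv_cancel_right]; exact hs
    · rw [h2.eq, inv_mul_cancel_right]; exact hs
  apply comm_closure_le
  · rintro x rfl
    exact key _ hg
  · rintro x (rfl | rfl)
    · exact key _ hg
    · exact key _ (hy.pow_left n)
  · rintro x rfl z (rfl | rfl)
    · simp
    · rw [comm_pow_central hy]
      exact Subgroup.mem_zpowers _

theorem torsion_aux {Q : Type*} [Group Q] {c : Q} {i k : ℕ} (hik : i < k)
    (h : c ^ (2 ^ i) ∈ Subgroup.zpowers (c ^ (2 ^ k))) : IsOfFinOrder c := by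
  obtain ⟨m, hm⟩ := Subgroup.mem_zpowers_iff.mp h
  rw [isOfFinOrder_iff_zpow_eq_one]
  refine ⟨2 ^ k * m - 2 ^ i, ?_, ?_⟩
  · intro h0
    obtain ⟨d, rfl⟩ := Nat.exists_eq_add_of_lt hik
    have h1 : (2 : ℤ) ^ i * (2 * (2 ^ d * m)) = 2 ^ i * 1 := by
      rw [pow_add, pow_add] at h0
      linarith
    have h2 := mul_left_cancel₀ (by positivity) h1
    omega
  · have e1 : c ^ ((2 : ℤ) ^ k * m) = (c ^ (2 ^ k)) ^ m := by
      rw [zpow_mul]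
      congr 1
      rw [← zpow_natCast]; push_cast; rfl
    have e2 : c ^ ((2 : ℤ) ^ i) = c ^ (2 ^ i) := by
      rw [← zpow_natCast]; push_cast; rfl
    rw [zpow_sub, e1, e2, hm, mul_inv_cancel]

theorem pair_finite (hA : ∀ a ∈ commutator G, ∀ b ∈ commutator G, a * b = b * a)
    (hnp : ∃ g : G, ¬IsOfFinOrder g) (hG : PropKInf G) {g : G} (hg : ¬IsOfFinOrder g) (y : G) :
    Finite (⁅Subgroup.closure {g}, Subgroup.closure {g, y}⁆ : Subgroup G) := by
  have n1 := VA_normal hA g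
  have n2 := VA_normal hA y
  have f1 := VA_finite_all hA hnp hG g
  have f2 := VA_finite_all hA hnp hG y
  obtain ⟨F, hFn, hFf, hF1, hF2⟩ : ∃ F : Subgroup G, F.Normal ∧ (F : Set G).Finite ∧
      VA hA g ≤ F ∧ VA hA y ≤ F := by
    refine ⟨VA hA g ⊔ VA hA y, inferInstance, ?_, le_sup_left, le_sup_right⟩
    rw [Subgroup.mul_normal]
    exact Set.Finite.mul (Set.toFinite _) (Set.toFinite _)
  let π := QuotientGroup.mk' F
  have hπ : ∀ z, π z = 1 ↔ z ∈ F := fun z => QuotientGroup.eq_one_iff z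
  have hcg : Commute (π g) ⁅π g, π y⁆ := by
    rw [commute_iff_eq, ← commutatorElement_eq_one_iff_mul_comm, ← map_commutatorElement,
      ← map_commutatorElement, hπ]
    exact hF1 ⟨_, comm_mem _ _, rfl⟩
  have hcy : Commute (π y) ⁅π g, π y⁆ := by
    rw [commute_iff_eq, ← commutatorElement_eq_one_iff_mul_comm, ← map_commutatorElement,
      ← map_commutatorElement, hπ]
    exact hF2 ⟨_, comm_mem _ _, rfl⟩
  have hle : ∀ n, (⁅Subgroup.closure {g}, Subgroup.closure {g, y ^ n}⁆ : Subgroup G).map π ≤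
      Subgroup.zpowers (⁅π g, π y⁆ ^ n) := by
    intro n
    rw [Subgroup.map_commutator, MonoidHom.map_closure, MonoidHom.map_closure,
      Set.image_singleton, Set.image_pair, map_pow]
    exact comm_le_zpowers hcg hcy n
  obtain ⟨i, hi⟩ := pigeon (hG (Subgroup.closure {g}))
    (fun j => ⁅Subgroup.closure {g}, Subgroup.closure {g, y ^ (2 ^ j)}⁆)
    (fun j => ⟨Subgroup.closure {g, y ^ (2 ^ j)},
      inf_closure hg (Set.mem_insert _ _), rfl⟩)
  obtain ⟨k, hik, hk⟩ := hi i
  have htor : IsOfFinOrder ⁅π g, π y⁆ := by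
    apply torsion_aux hik
    apply hle
    rw [hk, ← comm_pow_central hcy, ← map_pow, ← map_commutatorElement]
    apply Subgroup.mem_map_of_mem
    exact Subgroup.commutator_mem_commutator (Subgroup.subset_closure (Set.mem_singleton _))
      (Subgroup.subset_closure (Set.mem_insert_of_mem _ (Set.mem_singleton _)))
  have hfinZ : (Subgroup.zpowers ⁅π g, π y⁆ : Set (G ⧸ F)).Finite := finite_zpowers.mpr htor
  have hpre : (Set.preimage π (Subgroup.zpowers ⁅π g, π y⁆ : Set (G ⧸ F))).Finite := by
    refine Set.Finite.preimage' hfinZ ?_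
    intro b _
    obtain ⟨h, rfl⟩ := QuotientGroup.mk'_surjective F b
    refine (hFf.image (fun z => h * z)).subset ?_
    intro z hz
    refine ⟨h⁻¹ * z, ?_, by simp⟩
    have hz' : π z = π h := hz
    have : π (h⁻¹ * z) = 1 := by rw [map_mul, map_inv, hz']; simp
    exact (hπ _).mp this
  refine Set.finite_coe_iff.mpr (hpre.subset ?_)
  intro z hz
  have h1 := hle 1
  rw [pow_one, pow_one] at h1
  exact h1 (Subgroup.mem_map_of_mem π hz)

theorem inf_fc (hA : ∀ a ∈ commutator G, ∀ b ∈ commutator G, a * b = b * a)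
    (hnp : ∃ g : G, ¬IsOfFinOrder g) (hG : PropKInf G) {g : G} (hg : ¬IsOfFinOrder g) :
    {z | ∃ k ∈ (Set.univ : Set G), z = ⁅g, k⁆}.Finite := by
  have h1 : (⋃ S ∈ {S : Subgroup G | (∃ H : Subgroup G, Infinite H ∧
      S = ⁅Subgroup.closure {g}, H⁆) ∧ (S : Set G).Finite}, (S : Set G)).Finite :=
    Set.Finite.biUnion ((hG (Subgroup.closure {g})).subset fun S hS => hS.1) fun S hS => hS.2
  refine h1.subset ?_
  rintro _ ⟨y, -, rfl⟩
  refine Set.mem_biUnion (x := ⁅Subgroup.closure {g}, Subgroup.closure {g, y}⁆)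
    ⟨⟨Subgroup.closure {g, y}, inf_closure hg (Set.mem_insert _ _), rfl⟩,
      Set.finite_coe_iff.mp (pair_finite hA hnp hG hg y)⟩ ?_
  exact Subgroup.commutator_mem_commutator (Subgroup.subset_closure (Set.mem_singleton _))
      (Subgroup.subset_closure (Set.mem_insert_of_mem _ (Set.mem_singleton _)))

theorem inf_tor (hA : ∀ a ∈ commutator G, ∀ b ∈ commutator G, a * b = b * a)
    (hnp : ∃ g : G, ¬IsOfFinOrder g) (hG : PropKInf G) {g : G} (hg : ¬IsOfFinOrder g) (y : G) :
    IsOfFinOrder ⁅g, y⁆ := by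
  have := pair_finite hA hnp hG hg y
  have hm : ⁅g, y⁆ ∈ ⁅Subgroup.closure {g}, Subgroup.closure {g, y}⁆ :=
    Subgroup.commutator_mem_commutator (Subgroup.subset_closure (Set.mem_singleton _))
      (Subgroup.subset_closure (Set.mem_insert_of_mem _ (Set.mem_singleton _)))
  exact (Subgroup.subtype _).isOfFinOrder
    (isOfFinOrder_of_finite (⟨⁅g, y⁆, hm⟩ : (⁅Subgroup.closure {g}, Subgroup.closure {g, y}⁆ : Subgroup G)))

theorem all_tor (hA : ∀ a ∈ commutator G, ∀ b ∈ commutator G, a * b = b * a)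
    (hnp : ∃ g : G, ¬IsOfFinOrder g) (hG : PropKInf G) (a : G) (ha : a ∈ commutator G) :
    IsOfFinOrder a := by
  rw [commutator_eq_closure] at ha
  induction ha using Subgroup.closure_induction with
  | mem z hz =>
    obtain ⟨x, y, rfl⟩ := hz
    obtain ⟨g, h, hg, hh, rfl⟩ := exists_inf_factor hA hnp hG x
    rw [comm_mul_left]
    have h1 : IsOfFinOrder (g * ⁅h, y⁆ * g⁻¹) :=
      (MulAut.conj g).toMonoidHom.isOfFinOrder (inf_tor hA hnp hG hh y)
    have hc : Commute (g * ⁅h, y⁆ * g⁻¹) ⁅g, y⁆ := hA _ (conj_mem g (comm_mem _ _)) _ (comm_mem _ _)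
    exact hc.isOfFinOrder_mul h1 (inf_tor hA hnp hG hg y)
  | one => exact IsOfFinOrder.one
  | mul u v hu hv h1 h2 =>
    rw [← commutator_eq_closure] at hu hv
    have hc : Commute u v := hA u hu v hv
    exact hc.isOfFinOrder_mul h1 h2
  | inv u _ h => exact h.inv

theorem all_fc (hA : ∀ a ∈ commutator G, ∀ b ∈ commutator G, a * b = b * a)
    (hnp : ∃ g : G, ¬IsOfFinOrder g) (hG : PropKInf G) (x : G) :
    {z | ∃ k ∈ (Set.univ : Set G), z = ⁅x, k⁆}.Finite := by
  obtain ⟨g, h, hg, hh, rfl⟩ := exists_inf_factor hA hnp hG x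
  exact fin_comm_mul (inf_fc hA hnp hG hg) (inf_fc hA hnp hG hh)

theorem conj_fc (hA : ∀ a ∈ commutator G, ∀ b ∈ commutator G, a * b = b * a)
    (hnp : ∃ g : G, ¬IsOfFinOrder g) (hG : PropKInf G) (x : G) :
    {z | ∃ w k : G, z = w * ⁅x, k⁆ * w⁻¹}.Finite := by
  have h1 : (⋃ u ∈ {z | ∃ k ∈ (Set.univ : Set G), z = ⁅x, k⁆},
      {z | ∃ k ∈ (Set.univ : Set G), z = ⁅u⁻¹ * x, k⁆}).Finite :=
    Set.Finite.biUnion (all_fc hA hnp hG x) fun u _ => all_fc hA hnp hG _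
  refine h1.subset ?_
  rintro _ ⟨w, k, rfl⟩
  refine Set.mem_biUnion (x := ⁅x, w⁆) ⟨w, trivial, rfl⟩ ⟨w * k * w⁻¹, trivial, ?_⟩
  simp only [commutatorElement_def]; group

theorem top_finite (hA : ∀ a ∈ commutator G, ∀ b ∈ commutator G, a * b = b * a)
    (hnp : ∃ g : G, ¬IsOfFinOrder g) (hG : PropKInf G) (g y : G) :
    Finite (⁅(⊤ : Subgroup G), Subgroup.closure {g, y}⁆ : Subgroup G) := by
  let E : Set G := {z | ∃ w k : G, z = w * ⁅g, k⁆ * w⁻¹} ∪ {z | ∃ w k : G, z = w * ⁅y, k⁆ * w⁻¹}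
  have hE : E.Finite := (conj_fc hA hnp hG g).union (conj_fc hA hnp hG y)
  have hTA : Subgroup.closure E ≤ commutator G := by
    rw [Subgroup.closure_le]
    rintro _ (⟨w, k, rfl⟩ | ⟨w, k, rfl⟩)
    · exact conj_mem w (comm_mem _ _)
    · exact conj_mem w (comm_mem _ _)
  have hconj : ∀ x : G, ∀ s ∈ Subgroup.closure E, x * s * x⁻¹ ∈ Subgroup.closure E := by
    intro x s hs
    induction hs using Subgroup.closure_induction with
    | mem z hz =>
      refine Subgroup.subset_closure ?_
      rcases hz with ⟨w, k, rfl⟩ | ⟨w, k, rfl⟩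
      · exact Or.inl ⟨x * w, k, by group⟩
      · exact Or.inr ⟨x * w, k, by group⟩
    | one => simp
    | mul u v _ _ hu hv =>
      have := Subgroup.mul_mem _ hu hv
      convert this using 1; group
    | inv u _ hu =>
      have := Subgroup.inv_mem _ hu
      convert this using 1; group
  have hNz : ∀ x : G, Nz (Subgroup.closure E) x := by
    intro x s hs
    refine ⟨hconj x s hs, ?_⟩
    simpa using hconj x⁻¹ s hs
  have hle : ⁅(⊤ : Subgroup G), Subgroup.closure {g, y}⁆ ≤ Subgroup.closure E := by
    rw [← Subgroup.closure_univ]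
    apply comm_closure_le
    · exact fun x _ => hNz x
    · exact fun x _ => hNz x
    · rintro x - z (rfl | rfl)
      · rw [← commutatorElement_inv]
        exact Subgroup.inv_mem _ (Subgroup.subset_closure (Or.inl ⟨1, x, by simp⟩))
      · rw [← commutatorElement_inv]
        exact Subgroup.inv_mem _ (Subgroup.subset_closure (Or.inr ⟨1, x, by simp⟩))
  have hfg : Group.FG (Subgroup.closure E) := by
    rw [Group.fg_iff_subgroup_fg]
    exact (Subgroup.fg_iff _).mpr ⟨E, rfl, hE⟩
  let ci : CommGroup (Subgroup.closure E) :=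
    { (inferInstance : Group (Subgroup.closure E)) with
      mul_comm := by
        rintro ⟨u, hu⟩ ⟨v, hv⟩
        exact Subtype.ext (hA u (hTA hu) v (hTA hv)) }
  have hfin : Finite (Subgroup.closure E) := by
    refine CommGroup.finite_of_fg_isMulTorsion _ ?_
    rintro ⟨u, hu⟩
    exact Submonoid.isOfFinOrder_coe.mp (all_tor hA hnp hG u (hTA hu))
  exact Finite.of_injective _ (Subgroup.inclusion_injective hle)

theorem main_aux (hA : ∀ a ∈ commutator G, ∀ b ∈ commutator G, a * b = b * a)
    (hnp : ∃ g : G, ¬IsOfFinOrder g) (hG : PropKInf G) : Finite (commutator G) := by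
  obtain ⟨g, hg⟩ := id hnp
  have h1 : (⋃ S ∈ {S : Subgroup G | (∃ H : Subgroup G, Infinite H ∧
      S = ⁅(⊤ : Subgroup G), H⁆) ∧ (S : Set G).Finite}, (S : Set G)).Finite :=
    Set.Finite.biUnion ((hG ⊤).subset fun S hS => hS.1) fun S hS => hS.2
  have h2 : (commutatorSet G).Finite := by
    refine h1.subset ?_
    rintro _ ⟨x, y, rfl⟩
    refine Set.mem_biUnion (x := ⁅(⊤ : Subgroup G), Subgroup.closure {g, y}⁆)
      ⟨⟨Subgroup.closure {g, y}, inf_closure hg (Set.mem_insert _ _), rfl⟩,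
        Set.finite_coe_iff.mp (top_finite hA hnp hG g y)⟩ ?_
    exact Subgroup.commutator_mem_commutator (Subgroup.mem_top x)
      (Subgroup.subset_closure (Set.mem_insert_of_mem _ (Set.mem_singleton _)))
  have := h2.to_subtype
  infer_instance

end main
end helpers

theorem stmt_15 (G : Type*) [Group G]
    (hmeta : (⁅commutator G, commutator G⁆ : Subgroup G) = ⊥)
    (hnp : ∃ g : G, ¬IsOfFinOrder g) (hG : PropKInf G) :
    Finite (commutator G) := by
  exact main_aux (hA_of hmeta) hnp hG
end

section
/- Let G be a group with the property K̄∞, let p be a prime, and let A be an abelian normal subgroup of G of exponent p (i.e., a^p = 1 for all a ∈ A). If g is any element of finite order of G, then the subgroup ⁅⟨g⟩, A⁆ generated by all commutators [x,a] with x in the cyclic subgroup ⟨g⟩ generated by g and a ∈ A is finite. -/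
open scoped commutatorElement

theorem aux_le (G : Type*) [Group G] (g : G) (hg : IsOfFinOrder g) (W H : Subgroup G)
    (hW : ∀ w ∈ W, g * w * g⁻¹ ∈ W) (hH : ∀ a ∈ H, ⁅g, a⁆ ∈ W) :
    ⁅Subgroup.zpowers g, H⁆ ≤ W := by
  rw [Subgroup.commutator_le]
  intro x hx a ha
  obtain ⟨n, rfl⟩ := (hg.mem_powers_iff_mem_zpowers).2 hx
  show ⁅g ^ n, a⁆ ∈ W
  induction n with
  | zero => simp
  | succ n ih =>
    have h : ⁅g ^ (n+1), a⁆ = (g * ⁅g ^ n, a⁆ * g⁻¹) * ⁅g, a⁆ := by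
      simp only [commutatorElement_def, pow_succ']
      group
    rw [h]
    exact W.mul_mem (hW _ (ih (hg.mem_powers_iff_mem_zpowers.1 ⟨n, rfl⟩))) (hH a ha)

theorem aux_eq (G : Type*) [Group G] (A : Subgroup G) (hnorm : A.Normal)
    (hab : ∀ x y : A, x * y = y * x) (g : G) (hg : IsOfFinOrder g) (W : Subgroup G)
    (hW : ∀ w ∈ W, g * w * g⁻¹ ∈ W) (hWB : ∀ w ∈ W, ∃ a ∈ A, ⁅g, a⁆ = w) :
    ∃ H : Subgroup G, (Infinite W → Infinite H) ∧ W = ⁅Subgroup.zpowers g, H⁆ := by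
  have hcA : ∀ a ∈ A, ⁅g, a⁆ ∈ A := fun a ha =>
    A.mul_mem (hnorm.conj_mem a ha g) (A.inv_mem ha)
  have hcomm : ∀ x ∈ A, ∀ y ∈ A, x * y = y * x := fun x hx y hy =>
    congrArg Subtype.val (hab ⟨x, hx⟩ ⟨y, hy⟩)
  have hmul : ∀ a ∈ A, ∀ b ∈ A, ⁅g, a * b⁆ = ⁅g, a⁆ * ⁅g, b⁆ := by
    intro a ha b hb
    have h1 : ⁅g, a * b⁆ = ⁅g, a⁆ * (a * ⁅g, b⁆ * a⁻¹) := by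
      simp only [commutatorElement_def]; group
    rw [h1, hcomm a ha _ (hcA b hb)]
    group
  let H : Subgroup G :=
    { carrier := {a | a ∈ A ∧ ⁅g, a⁆ ∈ W}
      one_mem' := ⟨A.one_mem, by simp⟩
      mul_mem' := fun {a b} ha hb => ⟨A.mul_mem ha.1 hb.1, by
        rw [hmul a ha.1 b hb.1]; exact W.mul_mem ha.2 hb.2⟩
      inv_mem' := fun {a} ha => ⟨A.inv_mem ha.1, by
        have := hmul a ha.1 a⁻¹ (A.inv_mem ha.1)
        rw [mul_inv_cancel, commutatorElement_one_right] at this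
        rw [eq_inv_of_mul_eq_one_right this.symm]
        exact W.inv_mem ha.2⟩ }
  refine ⟨H, fun hinf => ?_, le_antisymm ?_ (aux_le G g hg W H hW fun a ha => ha.2)⟩
  · refine Infinite.of_surjective (fun a : H => (⟨⁅g, (a : G)⁆, a.2.2⟩ : W)) ?_
    rintro ⟨w, hw⟩
    obtain ⟨a, ha, rfl⟩ := hWB w hw
    exact ⟨⟨a, ha, hw⟩, rfl⟩
  · intro w hw
    obtain ⟨a, ha, rfl⟩ := hWB w hw
    exact Subgroup.commutator_mem_commutator (Subgroup.mem_zpowers g) (show a ∈ H from ⟨ha, hw⟩)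

theorem aux_sep (A : Type*) [CommGroup A] (p : ℕ) (hp : p.Prime)
    (hexp : ∀ a : A, a ^ p = 1) (w : A) (hw : w ≠ 1) :
    ∃ f : A →* Multiplicative (ZMod p), f w ≠ 1 := by
  have := Fact.mk hp
  let : Module (ZMod p) (Additive A) := AddCommGroup.zmodModule (n := p) (fun x => hexp x.toMul)
  by_contra! h
  apply hw
  have := (Module.forall_dual_apply_eq_zero_iff (ZMod p) (Additive.ofMul w)).1 (fun f =>
    h (AddMonoidHom.toMultiplicativeRight.symm.symm f.toAddMonoidHom))
  exact this

theorem aux_desc (G : Type*) [Group G] (p : ℕ) (hp : p.Prime)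
    (A : Subgroup G) (hnorm : A.Normal) (hab : ∀ x y : A, x * y = y * x)
    (hexp : ∀ a ∈ A, a ^ p = 1) (g : G) (hg : IsOfFinOrder g) (W : Subgroup G)
    (hWA : W ≤ A) (hW : ∀ w ∈ W, g * w * g⁻¹ ∈ W) (hinf : Infinite W) :
    ∃ V : Subgroup G, V < W ∧ Infinite V ∧ ∀ w ∈ V, g * w * g⁻¹ ∈ V := by
  have := Fact.mk hp
  let : CommGroup A := { (inferInstance : Group A) with mul_comm := hab }
  obtain ⟨⟨w, hw⟩, hw1⟩ := exists_ne (1 : W)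
  obtain ⟨f, hf⟩ := aux_sep A p hp (fun a => Subtype.ext (hexp a a.2)) ⟨w, hWA hw⟩
    (fun h => hw1 (Subtype.ext (show w = 1 from congrArg (fun z : A => (z : G)) h)))
  have : Finite (Subgroup.zpowers g) := hg.finite_zpowers
  let ψ : W →* (Subgroup.zpowers g → Multiplicative (ZMod p)) :=
    { toFun := fun v x => f ⟨x * v * (x : G)⁻¹, hnorm.conj_mem v (hWA v.2) x⟩
      map_one' := by
        funext x
        show f _ = 1
        rw [← map_one f]; congr 1; ext; simp
      map_mul' := by
        intro a b
        funext x
        show f _ = f _ * f _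
        rw [← map_mul f]; congr 1; ext; simp }
  refine ⟨ψ.ker.map W.subtype, lt_of_le_of_ne (Subgroup.map_subtype_le _) ?_, ?_, ?_⟩
  · intro h
    have hw' := hw
    rw [← h] at hw'
    obtain ⟨v, hv, hvw⟩ := hw'
    have h2 := congrFun (show ψ v = 1 from hv) 1
    apply hf
    rw [← show _ = (1 : Multiplicative (ZMod p)) from h2]
    show _ = f _
    congr 1; ext
    simpa using hvw.symm
  · have hk : Infinite ψ.ker := by
      by_contra hfin
      rw [not_infinite_iff_finite] at hfin
      have : Finite (W ⧸ ψ.ker) :=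
        Finite.of_injective _ (QuotientGroup.kerLift_injective ψ)
      have : Finite W := Finite.of_equiv _ (Subgroup.groupEquivQuotientProdSubgroup (s := ψ.ker)).symm
      exact not_finite W
    exact (ψ.ker.equivMapOfInjective W.subtype W.subtype_injective).toEquiv.infinite_iff.1 hk
  · rintro _ ⟨v, hv, rfl⟩
    refine ⟨⟨g * v * g⁻¹, hW v v.2⟩, ?_, rfl⟩
    show ψ _ = 1
    funext x
    have h2 := congrFun (show ψ v = 1 from hv) (x * ⟨g, Subgroup.mem_zpowers g⟩)
    refine Eq.trans ?_ h2
    show f _ = f _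
    congr 1; ext
    simp [mul_assoc]

theorem stmt_16 (G : Type*) [Group G] (hG : PropKInf G) (p : ℕ) (hp : p.Prime)
    (A : Subgroup G) (hnorm : A.Normal) (hab : ∀ x y : A, x * y = y * x)
    (hexp : ∀ a ∈ A, a ^ p = 1) (g : G) (hg : IsOfFinOrder g) :
    Finite (⁅Subgroup.zpowers g, A⁆ : Subgroup G) := by
  have hcA : ∀ a ∈ A, ⁅g, a⁆ ∈ A := fun a ha =>
    A.mul_mem (hnorm.conj_mem a ha g) (A.inv_mem ha)
  have hcomm : ∀ x ∈ A, ∀ y ∈ A, x * y = y * x := fun x hx y hy =>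
    congrArg Subtype.val (hab ⟨x, hx⟩ ⟨y, hy⟩)
  have hmul : ∀ a ∈ A, ∀ b ∈ A, ⁅g, a * b⁆ = ⁅g, a⁆ * ⁅g, b⁆ := by
    intro a ha b hb
    have h1 : ⁅g, a * b⁆ = ⁅g, a⁆ * (a * ⁅g, b⁆ * a⁻¹) := by
      simp only [commutatorElement_def]; group
    rw [h1, hcomm a ha _ (hcA b hb)]
    group
  let c : A →* G :=
    { toFun := fun a => ⁅g, (a : G)⁆
      map_one' := by simp
      map_mul' := fun a b => hmul a a.2 b b.2 }
  have hBinv : ∀ w ∈ c.range, g * w * g⁻¹ ∈ c.range := by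
    rintro _ ⟨a, rfl⟩
    refine ⟨⟨g * a * g⁻¹, hnorm.conj_mem a a.2 g⟩, ?_⟩
    show ⁅g, g * (a : G) * g⁻¹⁆ = g * ⁅g, (a : G)⁆ * g⁻¹
    simp only [commutatorElement_def]; group
  have hle : ⁅Subgroup.zpowers g, A⁆ ≤ c.range :=
    aux_le G g hg c.range A hBinv fun a ha => ⟨⟨a, ha⟩, rfl⟩
  suffices hfin : Finite c.range from Finite.of_injective _ (Subgroup.inclusion_injective hle)
  by_contra hinf
  rw [not_finite_iff_infinite] at hinf
  let T : Set (Subgroup G) := {W | W ≤ c.range ∧ Infinite W ∧ ∀ w ∈ W, g * w * g⁻¹ ∈ W}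
  have hT : T.Finite := by
    refine (hG (Subgroup.zpowers g)).subset ?_
    rintro W ⟨hWB, hWi, hWg⟩
    obtain ⟨H, hH, hE⟩ := aux_eq G A hnorm hab g hg W hWg (fun w hw => by
      obtain ⟨a, rfl⟩ := hWB hw
      exact ⟨a, a.2, rfl⟩)
    exact ⟨H, hH hWi, hE⟩
  obtain ⟨W, ⟨hWB, hWi, hWg⟩, hmin⟩ := hT.exists_minimal ⟨c.range, le_rfl, hinf, hBinv⟩
  have hBA : c.range ≤ A := by
    rintro _ ⟨a, rfl⟩
    exact hcA a a.2
  obtain ⟨V, hVW, hVi, hVg⟩ :=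
    aux_desc G p hp A hnorm hab hexp g hg W (hWB.trans hBA) hWg hWi
  exact hVW.not_ge (hmin ⟨hVW.le.trans hWB, hVi, hVg⟩ hVW.le)
end

section
/- Let G be a solvable group with no non-trivial periodic divisible abelian normal subgroups, i.e., every normal subgroup N of G that is periodic, abelian, and divisible (for every a ∈ N and every positive integer n there exists b ∈ N with b^n = a) is trivial. If G has the property K̄∞, then the commutator subgroup ⁅G,G⁆ of G is finite. -/
namespace KInf
open LaurentPolynomial
open scoped Pointwise

abbrev RR := LaurentPolynomial ℤ

instance : Algebra.FiniteType ℤ RR := by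
  unfold RR LaurentPolynomial
  infer_instance

instance : IsNoetherianRing RR := Algebra.FiniteType.isNoetherianRing ℤ RR

instance : IsJacobsonRing ℤ := by
  rw [isJacobsonRing_iff_prime_eq]
  intro P hP
  by_cases h : P = ⊥
  · subst h
    refine le_antisymm ?_ Ideal.le_jacobson
    intro x hx
    rw [Ideal.mem_jacobson_bot] at hx
    have h1 := Int.isUnit_iff.1 (hx x)
    rw [Ideal.mem_bot]
    nlinarith [h1.resolve_right (by nlinarith)]
  · have := hP.isMaximal h
    exact Ideal.jacobson_eq_self_of_isMaximal

lemma finite_of_field (S : Type*) [CommRing S] [Algebra.FiniteType ℤ S]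
    (hS : IsField S) : Finite S := by
  let _ := hS.toField
  have h : Module.Finite ℤ S := finite_of_finite_type_of_isJacobsonRing ℤ S
  have : Algebra.IsIntegral ℤ S := Algebra.IsIntegral.of_finite ℤ S
  obtain ⟨p, hp⟩ := CharP.exists S
  rcases CharP.char_is_prime_or_zero S p with h1 | h1
  · have : Module.IsTorsion ℤ S := by
      intro x
      refine ⟨⟨(p : ℤ), ?_⟩, ?_⟩
      · simpa using h1.ne_zero
      · rw [Submonoid.smul_def]
        simp
    exact Module.finite_of_fg_torsion S this
  · subst h1
    have : CharZero S := CharP.charP_to_charZero S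
    have hinj : Function.Injective (algebraMap ℤ S) := by
      intro a b hab
      simpa using hab
    exact absurd (isField_of_isIntegral_of_isField hinj hS) Int.not_isField

lemma finite_quot (J : Ideal RR) (hJ : J.IsMaximal) : Finite (RR ⧸ J) := by
  have h0 : @Algebra.FiniteType ℤ RR _ _ (Ring.toIntAlgebra _) := by
    have h : Algebra.FiniteType ℤ RR := inferInstance
    have e : (inferInstance : Algebra ℤ RR) = Ring.toIntAlgebra _ := Subsingleton.elim _ _
    rw [← e]
    exact h
  have h2 : @Algebra.FiniteType ℤ (RR ⧸ J) _ _ (Ring.toIntAlgebra _) :=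
    @Algebra.FiniteType.of_surjective _ _ _ _ _ _ _ _ h0 (Ideal.Quotient.mk J).toIntAlgHom
      Ideal.Quotient.mk_surjective
  exact finite_of_field (RR ⧸ J) ((Ideal.Quotient.maximal_ideal_iff_isField_quotient J).1 hJ)

variable {M : Type*} [AddCommGroup M] [Module RR M]

/-- minimal infinite submodule -/
def MinInf (C : Submodule RR M) : Prop :=
  (C : Set M).Infinite ∧ ∀ N : Submodule RR M, N ≤ C → (N : Set M).Infinite → N = C

lemma finite_sup {N N' : Submodule RR M} (h : (N : Set M).Finite) (h' : (N' : Set M).Finite) :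
    ((N ⊔ N' : Submodule RR M) : Set M).Finite := by
  rw [Submodule.coe_sup]
  exact h.add h'

lemma MinInf.cyc {C : Submodule RR M} (hC : MinInf C) (c : M) (hc : c ∈ C) :
    (Submodule.span RR {c} : Set M).Finite := by
  by_contra hinf
  have hspan := hC.2 _ ((Submodule.span_singleton_le_iff_mem _ _).2 hc) hinf
  have hle : ∀ r s : RR, (Submodule.span RR {(r * s) • c}) ≤ Submodule.span RR {s • c} := by
    intro r s
    rw [Submodule.span_singleton_le_iff_mem, mul_smul]
    exact Submodule.smul_mem _ _ (Submodule.mem_span_singleton_self _)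
  let J : Ideal RR :=
    { carrier := {r | (Submodule.span RR {r • c} : Set M).Finite}
      add_mem' := by
        intro a b ha hb
        refine (finite_sup ha hb).subset ?_
        have : Submodule.span RR {(a + b) • c} ≤ Submodule.span RR {a • c} ⊔ Submodule.span RR {b • c} := by
          rw [Submodule.span_singleton_le_iff_mem, add_smul]
          exact Submodule.add_mem_sup (Submodule.mem_span_singleton_self _)
            (Submodule.mem_span_singleton_self _)
        exact this
      zero_mem' := by simp
      smul_mem' := by
        intro r s hs
        exact Set.Finite.subset hs (hle r s) }
  have hJmem : ∀ r, r ∈ J ↔ (Submodule.span RR {r • c} : Set M).Finite := fun r => Iff.rfl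
  have hJ : J.IsMaximal := by
    rw [Ideal.isMaximal_iff]
    refine ⟨?_, ?_⟩
    · rw [hJmem, one_smul]; exact hinf
    · intro I r hJI hr hrI
      have h1 : Submodule.span RR {r • c} = C := by
        refine hC.2 _ ?_ ?_
        · rw [Submodule.span_singleton_le_iff_mem]
          exact C.smul_mem _ hc
        · rw [hJmem] at hr; exact hr
      rw [← h1] at hc
      obtain ⟨s, hs⟩ := Submodule.mem_span_singleton.1 hc
      have h2 : (1 - s * r) ∈ J := by
        rw [hJmem, sub_smul, one_smul, mul_smul, hs, sub_self]
        simp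
      have := I.add_mem (hJI h2) (I.mul_mem_left s hrI)
      simpa using this
  have hfin := finite_quot J hJ
  have hfg : J.FG := IsNoetherian.noetherian J
  -- J • c finite
  have key : ∀ s : Finset RR, (∀ r ∈ s, r ∈ J) →
      ((Submodule.span RR ((fun r => r • c) '' (s : Set RR)) : Submodule RR M) : Set M).Finite := by
    intro s
    induction s using Finset.induction_on with
    | empty => simp
    | insert a s ha ih =>
      intro h
      rw [Finset.coe_insert, Set.image_insert_eq, Submodule.span_insert]
      exact finite_sup ((hJmem _).1 (h a (by simp))) (ih fun r hr => h r (by simp [hr]))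
  obtain ⟨s, hs⟩ := hfg
  have hW := key s (fun r hr => hs ▸ Submodule.subset_span hr)
  set W := Submodule.span RR ((fun r => r • c) '' (s : Set RR)) with hWdef
  have hJW : ∀ r ∈ J, r • c ∈ W := by
    intro r hr
    have h3 : J ≤ W.comap (LinearMap.toSpanSingleton RR M c) := by
      rw [← hs, Ideal.span, Submodule.span_le]
      intro x hx
      exact Submodule.subset_span ⟨x, hx, rfl⟩
    exact h3 hr
  apply hinf
  have h4 : (Set.range (fun q : RR ⧸ J => (Quotient.out q) • c) + (W : Set M)).Finite :=
    (Set.finite_range _).add hW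
  refine h4.subset ?_
  intro m hm
  obtain ⟨r, rfl⟩ := Submodule.mem_span_singleton.1 hm
  refine Set.mem_add.2 ⟨_, ⟨Ideal.Quotient.mk J r, rfl⟩, (r - Quotient.out (Ideal.Quotient.mk J r)) • c, hJW _ ?_, ?_⟩
  · rw [← Ideal.Quotient.eq]
    exact (Quotient.out_eq (Ideal.Quotient.mk J r)).symm
  · rw [sub_smul]; abel

lemma MinInf.dich {C : Submodule RR M} (hC : MinInf C) (r : RR) :
    (∀ c ∈ C, r • c = 0) ∨ (∀ c ∈ C, ∃ d ∈ C, r • d = c) := by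
  by_cases h : ((C.map (LinearMap.lsmul RR M r) : Submodule RR M) : Set M).Finite
  · left
    let K := C ⊓ LinearMap.ker (LinearMap.lsmul RR M r)
    have hK : (K : Set M).Infinite := by
      intro hK
      apply hC.1
      refine Set.Finite.of_finite_fibers (fun m => r • m) (h.subset ?_) ?_
      · rintro _ ⟨c, hc, rfl⟩
        exact ⟨c, hc, rfl⟩
      · rintro x ⟨c, hc, rfl⟩
        refine (hK.image (fun k => c + k)).subset ?_
        rintro d ⟨hd, hd2⟩
        refine ⟨d - c, ⟨C.sub_mem hd hc, ?_⟩, by simp⟩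
        simp only [Set.mem_preimage, Set.mem_singleton_iff] at hd2
        simp [smul_sub, hd2]
    have := hC.2 K inf_le_left hK
    intro c hc
    rw [← this] at hc
    exact hc.2
  · right
    have := hC.2 (C.map (LinearMap.lsmul RR M r)) (by
      rintro _ ⟨c, hc, rfl⟩
      exact C.smul_mem _ hc) h
    intro c hc
    rw [← this] at hc
    obtain ⟨d, hd, rfl⟩ := hc
    exact ⟨d, hd, rfl⟩

lemma MinInf.tors {C : Submodule RR M} (hC : MinInf C) (c : M) (hc : c ∈ C) :
    IsOfFinAddOrder c := by
  have h := hC.cyc c hc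
  have : Finite (Submodule.span RR {c}) := h
  have h2 := isOfFinAddOrder_of_finite (⟨c, Submodule.mem_span_singleton_self c⟩ : Submodule.span RR {c})
  exact (Submodule.span RR {c}).subtype.toAddMonoidHom.isOfFinAddOrder h2

lemma MinInf.per {C : Submodule RR M} (hC : MinInf C) (c : M) (hc : c ∈ C) :
    ∃ k : ℕ, 0 < k ∧ (T (k : ℤ) : RR) • c = c := by
  have h := hC.cyc c hc
  have : ¬ Function.Injective (fun n : ℕ => (⟨(T (n : ℤ) : RR) • c,
      Submodule.smul_mem _ _ (Submodule.mem_span_singleton_self c)⟩ : Submodule.span RR {c})) := by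
    have : Finite (Submodule.span RR {c}) := h
    exact not_injective_infinite_finite _
  simp only [Function.Injective, Subtype.mk.injEq, not_forall] at this
  obtain ⟨a, b, hab, hne⟩ := this
  wlog hlt : a < b generalizing a b
  · exact this b a hab.symm (Ne.symm hne) (by omega)
  refine ⟨b - a, by omega, ?_⟩
  have h2 := congrArg (fun m => (T (-(a : ℤ)) : RR) • m) hab
  simp only [← mul_smul, ← T_add] at h2
  rw [neg_add_cancel, T_zero, one_smul] at h2
  rw [Nat.cast_sub hlt.le, sub_eq_neg_add]
  exact h2.symm

lemma MinInf.prime {C : Submodule RR M} (hC : MinInf C)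
    (hred : ∀ D : AddSubgroup M, (∀ a ∈ D, IsOfFinAddOrder a) →
      (∀ a ∈ D, ∀ n : ℕ, 0 < n → ∃ b ∈ D, n • b = a) → D = ⊥) :
    ∃ p : ℕ, p.Prime ∧ ∀ c ∈ C, p • c = 0 := by
  by_contra! hcon
  have h1 : ∀ p : ℕ, p.Prime → ∀ c ∈ C, ∃ d ∈ C, p • d = c := by
    intro p hp
    rcases hC.dich (p : RR) with h | h
    · obtain ⟨c, hc, h2⟩ := hcon p hp
      exact absurd (by simpa [Nat.cast_smul_eq_nsmul] using h c hc) h2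
    · simpa [Nat.cast_smul_eq_nsmul] using h
  have h2 : ∀ n : ℕ, 0 < n → ∀ c ∈ C, ∃ d ∈ C, n • d = c := by
    intro n
    induction n using induction_on_primes with
    | zero => simp
    | one => intro _ c hc; exact ⟨c, hc, one_smul _ _⟩
    | prime_mul p a hp ih =>
      intro h c hc
      obtain ⟨d, hd, rfl⟩ := h1 p hp c hc
      obtain ⟨e, he, rfl⟩ := ih (Nat.pos_of_mul_pos_left h) d hd
      exact ⟨e, he, mul_smul _ _ _⟩
  have h3 := hred C.toAddSubgroup (fun a ha => hC.tors a ha) (fun a ha n hn => h2 n hn a ha)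
  apply hC.1
  have : (C : Set M) = {0} := by
    have := congrArg (fun D : AddSubgroup M => (D : Set M)) h3
    simpa using this
  rw [this]; exact Set.finite_singleton 0



section
variable {M : Type*} [AddCommGroup M] [Module RR M]

lemma T_per {c : M} {k : ℤ} (h : (T k : RR) • c = c) (j : ℤ) : (T (k * j) : RR) • c = c := by
  have hneg : (T (-k) : RR) • c = c := by
    conv_lhs => rw [← h]
    rw [← mul_smul, ← T_add, neg_add_cancel, T_zero, one_smul]
  induction j using Int.induction_on with
  | zero => simp
  | succ i ih => rw [mul_add, mul_one, T_add, mul_smul, h, ih]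
  | pred i ih => rw [mul_sub, mul_one, sub_eq_add_neg, T_add, mul_smul, hneg, ih]

lemma MinInf.hyper {C : Submodule RR M} (hC : MinInf C) (p : ℕ) (hp : p.Prime)
    (hpC : ∀ c ∈ C, p • c = 0) (k : ℕ) (hk : 0 < k) (hkC : ∀ c ∈ C, (T (k : ℤ) : RR) • c = c) :
    False := by
  have : Fact p.Prime := ⟨hp⟩
  let _ : Module (ZMod p) C := AddCommGroup.zmodModule (n := p) (fun x => Subtype.ext (hpC x x.2))
  have hinf : Infinite C := hC.1.to_subtype
  obtain ⟨c, hc⟩ := exists_ne (0 : C)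
  have : ∃ φ : Module.Dual (ZMod p) C, φ c ≠ 0 := by
    by_contra! h
    exact hc ((Module.forall_dual_apply_eq_zero_iff (ZMod p) c).1 h)
  obtain ⟨φ, hφ⟩ := this
  let f : C →+ (Fin k → ZMod p) :=
    { toFun := fun c i => φ ((T ((i : ℕ) : ℤ) : RR) • c)
      map_zero' := by ext i; simp
      map_add' := by intro a b; ext i; simp }
  have hker : Infinite f.ker := by
    by_contra h
    have h1 : Finite f.ker := not_infinite_iff_finite.1 h
    have : Finite C := (AddMonoidHom.finite_iff_finite_ker_range f).2 ⟨h1, inferInstance⟩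
    exact not_finite C
  let K : Submodule RR C :=
    { carrier := {c | ∀ r : RR, φ (r • c) = 0}
      add_mem' := by intro a b ha hb r; rw [smul_add, map_add, ha r, hb r, add_zero]
      zero_mem' := by intro r; simp
      smul_mem' := by intro s a ha r; rw [← mul_smul]; exact ha _ }
  have hle : ∀ a ∈ f.ker, a ∈ K := by
    intro a ha r
    have h1 : ∀ i : Fin k, φ ((T ((i : ℕ) : ℤ) : RR) • a) = 0 := fun i => congrFun ha i
    have h2 : ∀ j : ℤ, φ ((T j : RR) • a) = 0 := by
      intro j
      have hk' : (0 : ℤ) < k := by exact_mod_cast hk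
      have h3 : (T j : RR) • a = (T (j % k) : RR) • a := by
        conv_lhs => rw [← Int.emod_add_mul_ediv j k]
        rw [T_add, mul_smul, T_per (Subtype.ext (hkC a a.2))]
      have h4 := Int.emod_nonneg j hk'.ne'
      have h5 := Int.emod_lt_of_pos j hk'
      rw [h3]
      have := h1 ⟨(j % k).toNat, by omega⟩
      simpa [Int.toNat_of_nonneg h4] using this
    induction r using LaurentPolynomial.induction_on' with
    | add p q hp hq => rw [add_smul, map_add, hp, hq, add_zero]
    | C_mul_T n b =>
      have : (LaurentPolynomial.C b * T n : RR) • a = b • ((T n : RR) • a) := by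
        have hb : (LaurentPolynomial.C b : RR) = (b : RR) := by simp
        rw [hb, mul_smul, Int.cast_smul_eq_zsmul]
      rw [this, map_zsmul, h2, smul_zero]
  have hKinf : ((K : Set C)).Infinite := (Set.infinite_coe_iff.1 hker).mono hle
  have hKC := hC.2 (K.map C.subtype) (Submodule.map_subtype_le _ _) (by
    rw [Submodule.map_coe]
    exact hKinf.image (Subtype.val_injective.injOn))
  have hcK : (c : M) ∈ K.map C.subtype := by rw [hKC]; exact c.2
  obtain ⟨d, hd, hdc⟩ := hcK
  obtain rfl : d = c := Subtype.ext hdc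
  apply hφ
  simpa using hd 1

/-- The additive subgroup generated by `x^k`-commutators. -/
def DD (X : AddSubgroup M) (k : ℕ) : AddSubgroup M :=
  AddSubgroup.closure {m | ∃ j : ℤ, ∃ x ∈ X, m = (T ((k : ℤ) * j) : RR) • x - x}

lemma DD_anti (X : AddSubgroup M) (k l : ℕ) : DD X (k * l) ≤ DD X k := by
  refine AddSubgroup.closure_mono ?_
  rintro m ⟨j, x, hx, rfl⟩
  exact ⟨l * j, x, hx, by push_cast; rw [mul_assoc]⟩

lemma tower_not_mem (p : ℕ) (hp : p.Prime) (e : ℕ → M) (z : RR)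
    (hz : ∀ j n, z ^ j • e n = e (n - j))
    (hpe : ∀ n, p • e n = 0) (h0 : e 0 = 0) (h1 : e 1 ≠ 0) (q j : ℕ) (hq : 0 < q) (hj : ¬ q ∣ j) :
    e j ∉ AddSubgroup.closure (Set.range fun i => e (q * i)) := by
  have hjpos : 0 < j := Nat.pos_of_ne_zero (by rintro rfl; simp at hj)
  let S : ℕ → AddSubgroup M := fun i => AddSubgroup.closure {m | ∃ i' ≤ i, m = e (q * i')}
  have hmono : Monotone S := by
    intro a b hab
    refine AddSubgroup.closure_mono ?_
    rintro m ⟨i, hi, rfl⟩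
    exact ⟨i, hi.trans hab, rfl⟩
  have hkill : ∀ i, ∀ s ∈ S i, z ^ (q * i) • s = 0 := by
    intro i s hs
    induction hs using AddSubgroup.closure_induction with
    | mem x hx =>
      obtain ⟨i', hi', rfl⟩ := hx
      rw [hz, Nat.sub_eq_zero_of_le (Nat.mul_le_mul_left q hi'), h0]
    | zero => simp
    | add x y _ _ hx hy => rw [smul_add, hx, hy, add_zero]
    | neg x _ hx => rw [smul_neg, hx, neg_zero]
  have hdec : ∀ i, ∀ s ∈ S (i + 1), ∃ t ∈ S i, ∃ a : ℤ, s = t + a • e (q * (i + 1)) := by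
    intro i s hs
    induction hs using AddSubgroup.closure_induction with
    | mem x hx =>
      obtain ⟨i', hi', rfl⟩ := hx
      rcases Nat.lt_or_ge i i' with h | h
      · obtain rfl : i' = i + 1 := by omega
        exact ⟨0, zero_mem _, 1, by simp⟩
      · exact ⟨_, AddSubgroup.subset_closure ⟨i', h, rfl⟩, 0, by simp⟩
    | zero => exact ⟨0, zero_mem _, 0, by simp⟩
    | add x y _ _ hx hy =>
      obtain ⟨t, ht, a, rfl⟩ := hx
      obtain ⟨t', ht', a', rfl⟩ := hy
      exact ⟨t + t', add_mem ht ht', a + a', by rw [add_smul]; abel⟩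
    | neg x _ hx =>
      obtain ⟨t, ht, a, rfl⟩ := hx
      exact ⟨-t, neg_mem ht, -a, by rw [neg_smul]; abel⟩
  have hnot : ∀ i, e j ∉ S i := by
    intro i
    induction i with
    | zero =>
      intro h
      have := hkill 0 _ h
      simp only [mul_zero, pow_zero, one_smul] at this
      have h2 := hz (j - 1) j
      rw [this, smul_zero, show j - (j - 1) = 1 by omega] at h2
      exact h1 h2.symm
    | succ i ih =>
      intro h
      obtain ⟨t, ht, a, hta⟩ := hdec i _ h
      rcases Nat.lt_or_ge j (q * (i + 1)) with hlt | hge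
      · have h2 := congrArg (fun m => z ^ (q * (i + 1) - 1) • m) hta
        simp only [smul_add] at h2
        have h3 : z ^ (q * (i + 1) - 1) • t = 0 := by
          have : q * (i + 1) - 1 = (q - 1) + q * i := by
            rw [mul_add, mul_one]; omega
          rw [this, pow_add, mul_smul, hkill i t ht, smul_zero]
        rw [hz, Nat.sub_eq_zero_of_le (by omega), h0, h3, zero_add, smul_comm, hz,
          show q * (i + 1) - (q * (i + 1) - 1) = 1 by omega] at h2
        have h4 : addOrderOf (e 1) = p := by
          have := Fact.mk hp
          exact addOrderOf_eq_prime (hpe 1) h1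
        have h5 : (p : ℤ) ∣ a := by
          rw [← h4]; exact addOrderOf_dvd_iff_zsmul_eq_zero.2 h2.symm
        obtain ⟨b, rfl⟩ := h5
        rw [mul_comm, mul_smul, natCast_zsmul, hpe, smul_zero, add_zero] at hta
        exact ih (hta ▸ ht)
      · have hgt : q * (i + 1) < j := lt_of_le_of_ne hge (by rintro rfl; exact hj ⟨_, rfl⟩)
        have h2 := hkill _ _ h
        have h3 := hz (q * (i + 1) + (j - 1 - q * (i + 1))) j
        rw [add_comm, pow_add, mul_smul, h2, smul_zero,
          show j - (j - 1 - q * (i + 1) + q * (i + 1)) = 1 by omega] at h3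
        exact h1 h3.symm
  intro h
  have : ∃ i, e j ∈ S i := by
    have : ∀ s ∈ AddSubgroup.closure (Set.range fun i => e (q * i)), ∃ i, s ∈ S i := by
      intro s hs
      induction hs using AddSubgroup.closure_induction with
      | mem x hx =>
        obtain ⟨i, rfl⟩ := hx
        exact ⟨i, AddSubgroup.subset_closure ⟨i, le_rfl, rfl⟩⟩
      | zero => exact ⟨0, zero_mem _⟩
      | add x y _ _ hx hy =>
        obtain ⟨a, ha⟩ := hx
        obtain ⟨b, hb⟩ := hy
        exact ⟨max a b, add_mem (hmono (le_max_left _ _) ha) (hmono (le_max_right _ _) hb)⟩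
      | neg x _ hx =>
        obtain ⟨a, ha⟩ := hx
        exact ⟨a, neg_mem ha⟩
    exact this _ h
  obtain ⟨i, hi⟩ := this
  exact hnot i hi

lemma tower (p : ℕ) (hp : p.Prime) (e : ℕ → M) (k : ℕ) (hk : 0 < k)
    (hz1 : ∀ n, ((T (k : ℤ) : RR) - 1) • e (n + 1) = e n)
    (hpe : ∀ n, p • e n = 0) (h0 : e 0 = 0) (h1 : e 1 ≠ 0)
    (hfin : ∀ X : AddSubgroup M, {S | ∃ k : ℕ, 0 < k ∧ S = DD X k}.Finite) : False := by
  set z : RR := (T (k : ℤ) : RR) - 1 with hzdef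
  have hz : ∀ j n, z ^ j • e n = e (n - j) := by
    intro j
    induction j with
    | zero => simp
    | succ j ih =>
      intro n
      rw [pow_succ, mul_smul]
      cases n with
      | zero => simp [h0]
      | succ n => rw [hz1, ih]; congr 1; omega
  have hq : ∀ n m, (T ((k * p ^ n : ℕ) : ℤ) : RR) • e m = e m + e (m - p ^ n) := by
    intro n m
    obtain ⟨r, hr⟩ := exists_add_pow_prime_pow_eq hp z (1 : RR) n
    have : (T ((k * p ^ n : ℕ) : ℤ) : RR) = (z + 1) ^ (p ^ n) := by
      rw [hzdef, sub_add_cancel, T_pow]; congr 1; push_cast; ring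
    rw [this, hr, one_pow, add_smul, add_smul, hz, one_smul,
      show (p : RR) * z * 1 * r = z * r * p by ring, mul_smul (z * r), Nat.cast_smul_eq_nsmul, hpe, smul_zero, add_zero, add_comm]
  let X : AddSubgroup M := AddSubgroup.closure (Set.range fun m => e (p ^ m))
  have hmem : ∀ n, e (p ^ (n + 1) - p ^ n) ∈ DD X (k * p ^ n) := by
    intro n
    refine AddSubgroup.subset_closure ⟨1, e (p ^ (n + 1)), AddSubgroup.subset_closure ⟨n + 1, rfl⟩, ?_⟩
    rw [mul_one, hq, add_sub_cancel_left]
  have hsub : ∀ n, DD X (k * p ^ n) ≤ AddSubgroup.closure (Set.range fun i => e (p ^ n * i)) := by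
    intro n
    set Sq := AddSubgroup.closure (Set.range fun i => e (p ^ n * i)) with hSq
    have hgen : ∀ i, e (p ^ n * i) ∈ Sq := fun i => AddSubgroup.subset_closure ⟨i, rfl⟩
    have hpos : ∀ i, (T ((k * p ^ n : ℕ) : ℤ) : RR) • e (p ^ n * i) ∈ Sq := by
      intro i
      rw [hq]
      refine add_mem (hgen i) ?_
      have : p ^ n * i - p ^ n = p ^ n * (i - 1) := by rw [Nat.mul_sub, mul_one]
      rw [this]; exact hgen _
    have hneg : ∀ i, (T (-((k * p ^ n : ℕ) : ℤ)) : RR) • e (p ^ n * i) ∈ Sq := by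
      intro i
      induction i with
      | zero => simp [h0]
      | succ i ih =>
        have h3 := congrArg (fun m => (T (-((k * p ^ n : ℕ) : ℤ)) : RR) • m) (hq n (p ^ n * (i + 1)))
        simp only [smul_add] at h3
        rw [← mul_smul, ← T_add, neg_add_cancel, T_zero, one_smul,
          show p ^ n * (i + 1) - p ^ n = p ^ n * i by rw [mul_add, mul_one]; omega] at h3
        have h4 := sub_mem (hgen (i + 1)) ih
        rwa [h3, add_sub_cancel_right] at h4
    have ext : ∀ r : RR, (∀ i, r • e (p ^ n * i) ∈ Sq) → ∀ s ∈ Sq, r • s ∈ Sq := by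
      intro r hr s hs
      induction hs using AddSubgroup.closure_induction with
      | mem x hx => obtain ⟨i, rfl⟩ := hx; exact hr i
      | zero => rw [smul_zero]; exact zero_mem _
      | add x y _ _ hx hy => rw [smul_add]; exact add_mem hx hy
      | neg x _ hx => rw [smul_neg]; exact neg_mem hx
    have hall : ∀ j : ℤ, ∀ s ∈ Sq, (T (((k * p ^ n : ℕ) : ℤ) * j) : RR) • s ∈ Sq := by
      intro j
      induction j using Int.induction_on with
      | zero => simp
      | succ i ih =>
        intro s hs
        rw [mul_add, mul_one, T_add, mul_smul]
        exact ih _ (ext _ hpos s hs)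
      | pred i ih =>
        intro s hs
        rw [mul_sub, mul_one, sub_eq_add_neg, T_add, mul_smul]
        exact ih _ (ext _ hneg s hs)
    rw [DD, AddSubgroup.closure_le]
    rintro m ⟨j, x, hx, rfl⟩
    induction hx using AddSubgroup.closure_induction with
    | mem x hx =>
      obtain ⟨m, rfl⟩ := hx
      simp only
      rcases le_total m n with h | h
      · have h3 : (T ((k * p ^ n : ℕ) : ℤ) : RR) • e (p ^ m) = e (p ^ m) := by
          rw [hq, Nat.sub_eq_zero_of_le (Nat.pow_le_pow_right hp.pos h), h0, add_zero]
        rw [T_per h3, sub_self]; exact zero_mem _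
      · obtain ⟨i, hi⟩ := pow_dvd_pow p h
        rw [hi]
        exact sub_mem (hall j _ (hgen i)) (hgen i)
    | zero => rw [smul_zero, sub_zero]; exact zero_mem _
    | add x y _ _ hx hy => rw [smul_add, add_sub_add_comm]; exact add_mem hx hy
    | neg x _ hx => 
      have : (T (((k * p ^ n : ℕ) : ℤ) * j) : RR) • (-x) - -x = -((T (((k * p ^ n : ℕ) : ℤ) * j) : RR) • x - x) := by
        rw [smul_neg]; abel
      rw [this]; exact neg_mem hx
  have hinj : Function.Injective (fun n => DD X (k * p ^ n)) := by
    intro a b hab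
    by_contra hne
    wlog hlt : a < b generalizing a b
    · exact this hab.symm (Ne.symm hne) (by omega)
    simp only at hab
    have h2 := hmem a
    rw [hab] at h2
    have h3 : DD X (k * p ^ b) ≤ DD X (k * p ^ (a + 1)) := by
      have : k * p ^ b = k * p ^ (a + 1) * p ^ (b - (a + 1)) := by
        rw [mul_assoc, ← pow_add]; congr 2; omega
      rw [this]; exact DD_anti _ _ _
    refine tower_not_mem p hp e z hz hpe h0 h1 (p ^ (a + 1)) _ (pow_pos hp.pos _) ?_ (hsub _ (h3 h2))
    intro hd
    have h4 : p ^ a < p ^ (a + 1) := Nat.pow_lt_pow_right hp.one_lt (Nat.lt_succ_self a)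
    have h5 : 0 < p ^ a := pow_pos hp.pos a
    have := Nat.le_of_dvd (by omega) hd
    omega
  exact Set.infinite_of_injective_forall_mem (s := {S | ∃ k : ℕ, 0 < k ∧ S = DD X k}) hinj
    (fun n => ⟨k * p ^ n, Nat.mul_pos hk (pow_pos hp.pos n), rfl⟩) (hfin X)

theorem module_main
    (hfinM : {N : Submodule RR M | (∀ c ∈ N, ∃ d : M, c = (T 1 : RR) • d - d) ∧
      (N : Set M).Infinite}.Finite)
    (hred : ∀ D : AddSubgroup M, (∀ a ∈ D, IsOfFinAddOrder a) →
      (∀ a ∈ D, ∀ n : ℕ, 0 < n → ∃ b ∈ D, n • b = a) → D = ⊥)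
    (hfin : ∀ X : AddSubgroup M, {S | ∃ k : ℕ, 0 < k ∧ S = DD X k}.Finite) :
    (Set.range fun d : M => (T 1 : RR) • d - d).Finite := by
  by_contra hinf
  let B : Submodule RR M := LinearMap.range (LinearMap.lsmul RR M (T 1 - 1))
  have hB : B ∈ {N : Submodule RR M | (∀ c ∈ N, ∃ d : M, c = (T 1 : RR) • d - d) ∧
      (N : Set M).Infinite} := by
    refine ⟨?_, ?_⟩
    · rintro _ ⟨d, rfl⟩
      exact ⟨d, by simp⟩
    · have : (B : Set M) = Set.range fun d : M => (T 1 : RR) • d - d := by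
        ext m; simp [B]
      rw [this]; exact hinf
  obtain ⟨C, hC⟩ := hfinM.exists_minimal ⟨B, hB⟩
  have hmin : MinInf C := by
    refine ⟨hC.1.2, fun N hN hNi => le_antisymm hN (hC.2 ⟨fun c hc => hC.1.1 c (hN hc), hNi⟩ hN)⟩
  obtain ⟨p, hp, hpC⟩ := hmin.prime hred
  obtain ⟨c, hc, hc0⟩ := hmin.1.exists_notMem_finite (Set.finite_singleton 0)
  obtain ⟨k, hk, hkc⟩ := hmin.per c hc
  rcases hmin.dich ((T (k : ℤ) : RR) - 1) with h | h
  · refine hmin.hyper p hp hpC k hk fun c hc => ?_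
    have := h c hc
    rwa [sub_smul, one_smul, sub_eq_zero] at this
  · choose! g hg hg2 using h
    let e' : ℕ → M := fun n => Nat.rec c (fun _ m => g m) n
    have he'C : ∀ n, e' n ∈ C := by
      intro n
      induction n with
      | zero => exact hc
      | succ n ih => exact hg _ ih
    let e : ℕ → M := fun n => Nat.casesOn n 0 e'
    have heC : ∀ n, e n ∈ C := by
      intro n
      cases n with
      | zero => exact zero_mem _
      | succ n => exact he'C n
    refine tower p hp e k hk ?_ (fun n => hpC _ (heC n)) rfl hc0 hfin
    intro n
    cases n with
    | zero =>
      change ((T (k : ℤ) : RR) - 1) • c = 0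
      rw [sub_smul, one_smul, hkc, sub_self]
    | succ n => exact hg2 _ (he'C n)
end


section
open scoped commutatorElement
lemma exists_module (M : Type*) [AddCommGroup M] (ρ : Multiplicative ℤ →* AddMonoid.End M) :
    ∃ _ : Module RR M, ∀ (n : ℤ) (m : M), (T n : RR) • m = ρ (Multiplicative.ofAdd n) m := by
  let f : RR →+* AddMonoid.End M := (AddMonoidAlgebra.lift ℤ (AddMonoid.End M) ℤ ρ).toRingHom
  refine ⟨Module.compHom M f, fun n m => ?_⟩
  change f (T n) m = _
  have : f (T n) = ρ (Multiplicative.ofAdd n) := by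
    change AddMonoidAlgebra.lift ℤ (AddMonoid.End M) ℤ ρ (AddMonoidAlgebra.single n 1) = _
    rw [AddMonoidAlgebra.lift_single, one_smul]
  rw [this]

lemma comm_sup {G : Type*} [Group G] (A : Subgroup G) [A.Normal]
    (hA : ∀ a ∈ A, ∀ b ∈ A, a * b = b * a) (X K : Subgroup G) (hX : X ≤ A) :
    ⁅X, K ⊔ A⁆ = ⁅X, K⁆ := by
  refine le_antisymm ?_ (Subgroup.commutator_mono le_rfl le_sup_left)
  rw [Subgroup.commutator_le]
  intro g hg h hh
  obtain ⟨k, hk, a, ha, rfl⟩ := Subgroup.mem_sup_of_normal_right.1 hh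
  have h1 : ⁅g, k * a⁆ = ⁅g, k⁆ := by
    rw [commutatorElement_mul_right_eq_mul_conj, commutatorElement_eq_one_iff_mul_comm.2 (hA g (hX hg) a ha)]
    simp
  rw [h1]
  exact Subgroup.commutator_mem_commutator hg hk

lemma finite_sup' {G : Type*} [Group G] (A : Subgroup G)
    (hA : ∀ a ∈ A, ∀ b ∈ A, a * b = b * a) (S W : Subgroup G) (hS : S ≤ A) (hW : W ≤ A)
    (h1 : (S : Set G).Finite) (h2 : (W : Set G).Finite) : ((S ⊔ W : Subgroup G) : Set G).Finite := by
  let P : Subgroup G :=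
    { carrier := (S : Set G) * (W : Set G)
      one_mem' := Set.mem_mul.2 ⟨1, S.one_mem, 1, W.one_mem, one_mul 1⟩
      mul_mem' := by
        rintro _ _ ⟨s, hs, w, hw, rfl⟩ ⟨s', hs', w', hw', rfl⟩
        refine ⟨s * s', S.mul_mem hs hs', w * w', W.mul_mem hw hw', ?_⟩
        have := hA w (hW hw) s' (hS hs')
        simp only [mul_assoc]
        rw [← mul_assoc w s' w', this, mul_assoc]
      inv_mem' := by
        rintro _ ⟨s, hs, w, hw, rfl⟩
        refine ⟨s⁻¹, S.inv_mem hs, w⁻¹, W.inv_mem hw, ?_⟩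
        have := hA _ (hS hs) _ (hW hw)
        simp only
        rw [this, mul_inv_rev] }
  have : S ⊔ W ≤ P := by
    refine sup_le ?_ ?_
    · intro s hs; exact ⟨s, hs, 1, W.one_mem, mul_one s⟩
    · intro w hw; exact ⟨1, S.one_mem, w, hw, one_mul w⟩
  exact (h1.mul h2).subset this

lemma T_sub_mem {M : Type*} [AddCommGroup M] [Module RR M] (N : Submodule RR M) (h : M)
    (hh : (T 1 : RR) • h - h ∈ N) (j : ℤ) : (T j : RR) • h - h ∈ N := by
  rw [← Submodule.Quotient.eq] at hh ⊢
  rw [Submodule.Quotient.mk_smul] at hh ⊢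
  have := T_per hh j
  rwa [one_mul] at this

lemma bridge {G : Type*} [Group G] (hG : PropKInf G) (A : Subgroup G) [A.Normal]
    (hA : ∀ a ∈ A, ∀ b ∈ A, a * b = b * a) (hinf : Infinite A)
    (hred : ∀ D : Subgroup G, D ≤ A → (∀ a ∈ D, IsOfFinOrder a) →
      (∀ a ∈ D, ∀ n : ℕ, 0 < n → ∃ b ∈ D, b ^ n = a) → D = ⊥) (x : G)
    {M : Type*} [AddCommGroup M] [Module RR M] (ι : Multiplicative M →* G)
    (hinj : Function.Injective ι) (hrange : ι.range = A)
    (hT : ∀ (n : ℤ) (m : M), ι (Multiplicative.ofAdd ((T n : RR) • m)) =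
      x ^ n * ι (Multiplicative.ofAdd m) * (x ^ n)⁻¹) :
    ((⁅A, Subgroup.zpowers x⁆ : Subgroup G) : Set G).Finite := by
  let img : AddSubgroup M → Subgroup G := fun D => (AddSubgroup.toSubgroup D).map ι
  have himg : ∀ D g, g ∈ img D ↔ ∃ m ∈ D, ι (Multiplicative.ofAdd m) = g := by
    intro D g; rfl
  have imginj : Function.Injective img :=
    (Subgroup.map_injective hinj).comp AddSubgroup.toSubgroup.injective
  have imgA : ∀ D, img D ≤ A := by
    intro D
    rintro _ ⟨m, hm, rfl⟩
    rw [← hrange]; exact ⟨m, rfl⟩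
  have imgtop : img ⊤ = A := by
    refine le_antisymm (imgA _) ?_
    rw [← hrange]
    rintro _ ⟨m, rfl⟩
    exact ⟨m, trivial, rfl⟩
  have hsub : ∀ a b : M, ι (Multiplicative.ofAdd (a - b)) =
      ι (Multiplicative.ofAdd a) * (ι (Multiplicative.ofAdd b))⁻¹ := by
    intro a b
    rw [sub_eq_add_neg, ofAdd_add, ofAdd_neg, map_mul, map_inv]
  have hcom : ∀ (n : ℤ) (m : M), ι (Multiplicative.ofAdd ((T n : RR) • m - m)) =
      ⁅x ^ n, ι (Multiplicative.ofAdd m)⁆ := by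
    intro n m
    rw [hsub, hT, commutatorElement_def]
  have key : ∀ (X : AddSubgroup M) (k : ℕ), ⁅img X, Subgroup.zpowers (x ^ k)⁆ = img (DD X k) := by
    intro X k
    rw [Subgroup.commutator_comm]
    refine le_antisymm ?_ ?_
    · rw [Subgroup.commutator_le]
      rintro _ ⟨j, rfl⟩ _ ⟨m, hm, rfl⟩
      refine (himg _ _).2 ⟨(T ((k : ℤ) * j) : RR) • Multiplicative.toAdd m - Multiplicative.toAdd m,
        AddSubgroup.subset_closure ⟨j, _, hm, rfl⟩, ?_⟩
      rw [hcom, zpow_mul, zpow_natCast]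
      rfl
    · rintro _ ⟨m, hm, rfl⟩
      change m.toAdd ∈ DD X k at hm
      change ι (Multiplicative.ofAdd m.toAdd) ∈ _
      generalize m.toAdd = m' at hm
      induction hm using AddSubgroup.closure_induction with
      | mem y hy =>
        obtain ⟨j, a, ha, rfl⟩ := hy
        rw [hcom, zpow_mul, zpow_natCast]
        exact Subgroup.commutator_mem_commutator ⟨j, rfl⟩ ⟨a, ha, rfl⟩
      | zero => rw [ofAdd_zero, map_one]; exact Subgroup.one_mem _
      | add a b _ _ ha hb => rw [ofAdd_add, map_mul]; exact Subgroup.mul_mem _ ha hb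
      | neg a _ ha => rw [ofAdd_neg, map_inv]; exact Subgroup.inv_mem _ ha
  have key1 : ∀ X : AddSubgroup M, ⁅img X, Subgroup.zpowers x⁆ = img (DD X 1) := by
    intro X
    have := key X 1
    rwa [pow_one] at this
  have hmain : (Set.range fun d : M => (T 1 : RR) • d - d).Finite := by
    refine module_main ?_ ?_ ?_
    · refine Set.Finite.of_finite_image (f := fun N : Submodule RR M => img N.toAddSubgroup)
        ((hG (Subgroup.zpowers x)).subset ?_) ?_
      · rintro _ ⟨N, ⟨hN1, hN2⟩, rfl⟩
        let H : Submodule RR M := N.comap (LinearMap.lsmul RR M (T 1 - 1))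
        have hH : ∀ m, m ∈ H ↔ (T 1 : RR) • m - m ∈ N := by
          intro m
          simp [H]
        refine ⟨img H.toAddSubgroup, ?_, ?_⟩
        · have h1 : (H : Set M).Infinite := by
            intro hf
            apply hN2
            refine (hf.image (fun m => (T 1 : RR) • m - m)).subset ?_
            intro c hc
            obtain ⟨d, rfl⟩ := hN1 c hc
            exact ⟨d, (hH d).2 hc, rfl⟩
          have h2 := h1.image (f := fun m => ι (Multiplicative.ofAdd m))
            (fun a _ b _ hab => Multiplicative.ofAdd.injective (hinj hab))
          exact h2.to_subtype
        · rw [Subgroup.commutator_comm, key1]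
          refine congrArg img ?_
          refine le_antisymm ?_ ?_
          · intro c hc
            obtain ⟨d, rfl⟩ := hN1 c hc
            exact AddSubgroup.subset_closure ⟨1, d, (hH d).2 hc, by simp⟩
          · rw [DD, AddSubgroup.closure_le]
            rintro _ ⟨j, d, hd, rfl⟩
            exact T_sub_mem N d ((hH d).1 hd) _
      · intro N _ N' _ h
        exact Submodule.toAddSubgroup_injective (imginj h)
    · intro D h1 h2
      have : img D = ⊥ := by
        refine hred (img D) (imgA D) ?_ ?_
        · rintro _ ⟨m, hm, rfl⟩
          refine ι.isOfFinOrder ?_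
          have := h1 _ hm
          rwa [← isOfFinAddOrder_ofMul_iff]
        · rintro _ ⟨m, hm, rfl⟩ n hn
          obtain ⟨b, hb, hb2⟩ := h2 _ hm n hn
          refine ⟨ι (Multiplicative.ofAdd b), (himg _ _).2 ⟨b, hb, rfl⟩, ?_⟩
          rw [← map_pow, ← ofAdd_nsmul, hb2]
          rfl
      apply imginj
      rw [this]
      symm
      rw [eq_bot_iff]
      rintro _ ⟨m, hm, rfl⟩
      have h3 : m = 1 := hm
      rw [h3, map_one]; exact Subgroup.one_mem _
    · intro X
      refine Set.Finite.of_finite_image (f := img) ((hG (img X)).subset ?_) imginj.injOn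
      rintro _ ⟨_, ⟨k, hk, rfl⟩, rfl⟩
      refine ⟨Subgroup.zpowers (x ^ k) ⊔ A, ?_, ?_⟩
      · exact Infinite.of_injective _ (Subgroup.inclusion_injective (le_sup_right : A ≤ Subgroup.zpowers (x ^ k) ⊔ A))
      · rw [comm_sup A hA _ _ (imgA X), key]
  rw [← imgtop, key1]
  refine (hmain.image (fun m => ι (Multiplicative.ofAdd m))).subset ?_
  rintro _ ⟨m, hm, rfl⟩
  refine ⟨m.toAdd, ?_, rfl⟩
  have h1 : DD (⊤ : AddSubgroup M) 1 ≤ (LinearMap.range (LinearMap.lsmul RR M (T 1 - 1))).toAddSubgroup := by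
    rw [DD, AddSubgroup.closure_le]
    rintro _ ⟨j, d, hd, rfl⟩
    exact T_sub_mem (LinearMap.range (LinearMap.lsmul RR M (T 1 - 1))) d ⟨d, by simp⟩ _
  obtain ⟨d, hd⟩ := h1 hm
  exact ⟨d, by rw [← hd]; simp; rfl⟩

lemma lemma2 {G : Type*} [Group G] (hG : PropKInf G) (A : Subgroup G) [A.Normal]
    (hA : ∀ a ∈ A, ∀ b ∈ A, a * b = b * a) (hinf : Infinite A)
    (hred : ∀ D : Subgroup G, D ≤ A → (∀ a ∈ D, IsOfFinOrder a) →
      (∀ a ∈ D, ∀ n : ℕ, 0 < n → ∃ b ∈ D, b ^ n = a) → D = ⊥) (x : G) :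
    ((⁅A, Subgroup.zpowers x⁆ : Subgroup G) : Set G).Finite := by
  let _ : CommGroup A := { (inferInstance : Group A) with
    mul_comm := fun a b => Subtype.ext (hA a a.2 b b.2) }
  let ρ : Multiplicative ℤ →* AddMonoid.End (Additive A) :=
    { toFun := fun n => MonoidHom.toAdditive (MulAut.conjNormal (x ^ n.toAdd) : MulAut A).toMonoidHom
      map_one' := by refine AddMonoidHom.ext fun a => ?_; change (MulAut.conjNormal (x ^ (0 : ℤ)) : MulAut A) a = a; simp; rfl
      map_mul' := by
        intro a b
        refine AddMonoidHom.ext fun c => ?_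
        change (MulAut.conjNormal (x ^ (a.toAdd + b.toAdd)) : MulAut A) c =
          (MulAut.conjNormal (x ^ a.toAdd) : MulAut A) ((MulAut.conjNormal (x ^ b.toAdd) : MulAut A) c)
        rw [zpow_add, map_mul]; rfl }
  obtain ⟨inst, h⟩ := exists_module (Additive A) ρ
  refine bridge hG A hA hinf hred x (M := Additive A)
    (A.subtype.comp (MulEquiv.multiplicativeAdditive A).toMonoidHom) ?_ ?_ ?_
  · exact Subtype.val_injective.comp (MulEquiv.multiplicativeAdditive A).injective
  · ext g
    constructor
    · rintro ⟨m, rfl⟩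
      exact Subtype.property _
    · intro hg
      exact ⟨Multiplicative.ofAdd (Additive.ofMul ⟨g, hg⟩), rfl⟩
  · intro n m
    rw [h]
    rfl

lemma lemma3 {G : Type*} [Group G] (hG : PropKInf G) (A : Subgroup G) [A.Normal]
    (hA : ∀ a ∈ A, ∀ b ∈ A, a * b = b * a)
    (hred : ∀ D : Subgroup G, D ≤ A → (∀ a ∈ D, IsOfFinOrder a) →
      (∀ a ∈ D, ∀ n : ℕ, 0 < n → ∃ b ∈ D, b ^ n = a) → D = ⊥) :
    ((⁅A, (⊤ : Subgroup G)⁆ : Subgroup G) : Set G).Finite := by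
  rcases finite_or_infinite A with hfin | hinf
  · exact Set.Finite.subset hfin (Subgroup.commutator_le_left A ⊤)
  · have h1 : (Set.range fun x : G => ⁅A, Subgroup.zpowers x⁆).Finite := by
      refine (hG A).subset ?_
      rintro _ ⟨x, rfl⟩
      refine ⟨Subgroup.zpowers x ⊔ A, ?_, ?_⟩
      · exact Infinite.of_injective _ (Subgroup.inclusion_injective (le_sup_right : A ≤ Subgroup.zpowers x ⊔ A))
      · rw [comm_sup A hA _ _ le_rfl]
    have h2 : ∀ S ∈ (Set.range fun x : G => ⁅A, Subgroup.zpowers x⁆), S ≤ A ∧ (S : Set G).Finite := by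
      rintro _ ⟨x, rfl⟩
      exact ⟨Subgroup.commutator_le_left A _, lemma2 hG A hA hinf hred x⟩
    have h3 : ⁅A, (⊤ : Subgroup G)⁆ ≤ sSup (Set.range fun x : G => ⁅A, Subgroup.zpowers x⁆) := by
      rw [Subgroup.commutator_le]
      intro a ha x _
      exact (le_sSup (Set.mem_range_self (f := fun x : G => ⁅A, Subgroup.zpowers x⁆) x))
        (Subgroup.commutator_mem_commutator ha (Subgroup.mem_zpowers x))
    have h4 : ∀ 𝒮 : Set (Subgroup G), 𝒮.Finite → (∀ S ∈ 𝒮, S ≤ A ∧ (S : Set G).Finite) →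
        sSup 𝒮 ≤ A ∧ ((sSup 𝒮 : Subgroup G) : Set G).Finite := by
      intro 𝒮 hS
      induction 𝒮, hS using Set.Finite.induction_on with
      | empty => intro _; simp
      | insert _ _ ih =>
        intro h
        rw [sSup_insert]
        have i1 := ih fun S hS => h S (Set.mem_insert_of_mem _ hS)
        have i2 := h _ (Set.mem_insert _ _)
        exact ⟨sup_le i2.1 i1.1, finite_sup' A hA _ _ i2.1 i1.1 i2.2 i1.2⟩
    exact (h4 _ h1 h2).2.subset h3
end


section
open scoped commutatorElement

def Per {G : Type*} [Group G] (D : Subgroup G) : Prop := ∀ a ∈ D, IsOfFinOrder a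
def Dvb {G : Type*} [Group G] (D : Subgroup G) : Prop :=
  ∀ a ∈ D, ∀ n : ℕ, 0 < n → ∃ b ∈ D, b ^ n = a
def NoDiv (G : Type*) [Group G] : Prop :=
  ∀ N : Subgroup G, N.Normal → (∀ a ∈ N, IsOfFinOrder a) → (∀ x y : N, x * y = y * x) →
      (∀ a ∈ N, ∀ n : ℕ, 0 < n → ∃ b ∈ N, b ^ n = a) → N = ⊥

lemma Per.map {G H : Type*} [Group G] [Group H] {D : Subgroup G} (h : Per D) (f : G →* H) :
    Per (D.map f) := by
  rintro _ ⟨a, ha, rfl⟩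
  exact f.isOfFinOrder (h a ha)

lemma Dvb.map {G H : Type*} [Group G] [Group H] {D : Subgroup G} (h : Dvb D) (f : G →* H) :
    Dvb (D.map f) := by
  rintro _ ⟨a, ha, rfl⟩ n hn
  obtain ⟨b, hb, rfl⟩ := h a ha n hn
  exact ⟨f b, ⟨b, hb, rfl⟩, (map_pow f b n).symm⟩

lemma NoDiv.red {G : Type*} [Group G] (h : NoDiv G) (A : Subgroup G) [A.Normal]
    (hA : ∀ a ∈ A, ∀ b ∈ A, a * b = b * a) (D : Subgroup G) (hD : D ≤ A) (h1 : Per D)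
    (h2 : Dvb D) : D = ⊥ := by
  have hle : Subgroup.normalClosure (D : Set G) ≤ A := Subgroup.normalClosure_le_normal hD
  have hN : Subgroup.normalClosure (D : Set G) = ⊥ := by
    refine h _ inferInstance ?_ ?_ ?_
    · intro a ha
      have : a ∈ A ∧ IsOfFinOrder a := by
        induction ha using Subgroup.closure_induction with
        | mem x hx =>
          refine ⟨hle (Subgroup.subset_closure hx), ?_⟩
          obtain ⟨d, hd, hc⟩ := Group.mem_conjugatesOfSet_iff.1 hx
          obtain ⟨g, rfl⟩ := isConj_iff.1 hc
          exact (MulAut.conj g).toMonoidHom.isOfFinOrder (h1 d hd)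
        | one => exact ⟨A.one_mem, IsOfFinOrder.one⟩
        | mul x y _ _ hx hy =>
          exact ⟨A.mul_mem hx.1 hy.1, Commute.isOfFinOrder_mul (hA x hx.1 y hy.1) hx.2 hy.2⟩
        | inv x _ hx => exact ⟨A.inv_mem hx.1, hx.2.inv⟩
      exact this.2
    · intro x y
      exact Subtype.ext (hA x (hle x.2) y (hle y.2))
    · intro a ha n hn
      induction ha using Subgroup.closure_induction with
      | mem x hx =>
        obtain ⟨d, hd, hc⟩ := Group.mem_conjugatesOfSet_iff.1 hx
        obtain ⟨g, rfl⟩ := isConj_iff.1 hc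
        obtain ⟨b, hb, rfl⟩ := h2 d hd n hn
        refine ⟨g * b * g⁻¹, ?_, conj_pow⟩
        exact Subgroup.normalClosure_normal.conj_mem _ (Subgroup.subset_normalClosure hb) g
      | one => exact ⟨1, Subgroup.one_mem _, one_pow n⟩
      | mul x y _ _ hx hy =>
        obtain ⟨b, hb, rfl⟩ := hx
        obtain ⟨c, hc, rfl⟩ := hy
        exact ⟨b * c, Subgroup.mul_mem _ hb hc, Commute.mul_pow (hA b (hle hb) c (hle hc)) n⟩
      | inv x _ hx =>
        obtain ⟨b, hb, rfl⟩ := hx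
        exact ⟨b⁻¹, Subgroup.inv_mem _ hb, inv_pow b n⟩
  rw [eq_bot_iff, ← hN]
  exact Subgroup.subset_normalClosure

lemma NoDiv.quot {G : Type*} [Group G] (h : NoDiv G) (F : Subgroup G) [F.Normal] (hF : Finite F) :
    NoDiv (G ⧸ F) := by
  intro Db hDn hDp hDc hDd
  let π := QuotientGroup.mk' F
  let D := Db.comap π
  have hDN : D.Normal := inferInstance
  let E := D ⊓ Subgroup.centralizer (F : Set G)
  have hEN : E.Normal := inferInstance
  set m := Nat.card F with hm
  have hmpos : 0 < m := Nat.card_pos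
  have hFm : ∀ f ∈ F, f ^ m = 1 := by
    intro f hf
    have := pow_card_eq_one' (G := F) (x := ⟨f, hf⟩)
    exact congrArg Subtype.val this
  have hEF : ∀ e ∈ E, ∀ f ∈ F, f * e = e * f := fun e he f hf =>
    Subgroup.mem_centralizer_iff.1 he.2 f hf
  have hfinAut : Finite (MulAut F) := Finite.of_injective (fun σ : MulAut F => (σ : F → F)) DFunLike.coe_injective
  set n := Nat.card (MulAut F) with hn
  have hnpos : 0 < n := Nat.card_pos
  have hcent : ∀ g : G, g ^ n ∈ Subgroup.centralizer (F : Set G) := by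
    intro g
    rw [Subgroup.mem_centralizer_iff]
    intro f hf
    have h1 : (MulAut.conjNormal (g ^ n) : MulAut F) = 1 := by
      rw [map_pow]; exact pow_card_eq_one'
    have h2 := congrArg (fun σ : MulAut F => ((σ ⟨f, hf⟩ : F) : G)) h1
    simp only [MulAut.conjNormal_apply, MulAut.one_apply] at h2
    rw [mul_inv_eq_iff_eq_mul] at h2
    exact h2.symm
  -- main decomposition
  have hdec : ∀ d ∈ D, ∀ k : ℕ, 0 < k → ∃ c ∈ E, ∃ f ∈ F, d = c ^ k * f := by
    intro d hd k hk
    obtain ⟨b, hb, hbd⟩ := hDd (π d) hd (n * k) (Nat.mul_pos hnpos hk)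
    obtain ⟨b, rfl⟩ := QuotientGroup.mk'_surjective F b
    refine ⟨b ^ n, ⟨D.pow_mem hb n, hcent b⟩, ((b ^ n) ^ k)⁻¹ * d, ?_, by simp⟩
    rw [← QuotientGroup.eq, ← pow_mul]
    exact hbd
  have hEab : ∀ a ∈ E, ∀ b ∈ E, a * b = b * a := by
    intro a ha b hb
    obtain ⟨c, hc, f, hf, rfl⟩ := hdec a ha.1 m hmpos
    have h1 : b * c * b⁻¹ * c⁻¹ ∈ F := by
      have := congrArg Subtype.val (hDc ⟨π b, hb.1⟩ ⟨π c, hc.1⟩)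
      have h3 : π (b * c * b⁻¹ * c⁻¹) = 1 := by
        simp only [map_mul, map_inv]
        change π b * π c = π c * π b at this
        rw [this]; group
      exact (QuotientGroup.eq_one_iff _).1 h3
    set f' := b * c * b⁻¹ * c⁻¹ with hf'
    have h2 : b * c * b⁻¹ = f' * c := by rw [hf']; group
    have h3 : b * c ^ m * b⁻¹ = c ^ m := by
      rw [← conj_pow, h2, Commute.mul_pow (hEF c hc f' h1), hFm f' h1, one_mul]
    have h4 : b * c ^ m = c ^ m * b := mul_inv_eq_iff_eq_mul.1 h3
    rw [mul_assoc, hEF b hb f hf, ← mul_assoc, ← h4, mul_assoc]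
  let N : Subgroup G :=
    { carrier := {g | ∃ e ∈ E, e ^ m = g}
      one_mem' := ⟨1, E.one_mem, one_pow m⟩
      mul_mem' := by
        rintro _ _ ⟨a, ha, rfl⟩ ⟨b, hb, rfl⟩
        exact ⟨a * b, E.mul_mem ha hb, Commute.mul_pow (hEab a ha b hb) m⟩
      inv_mem' := by
        rintro _ ⟨a, ha, rfl⟩
        exact ⟨a⁻¹, E.inv_mem ha, inv_pow a m⟩ }
  have hNE : N ≤ E := by
    rintro _ ⟨a, ha, rfl⟩
    exact E.pow_mem ha m
  have hNbot : N = ⊥ := by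
    refine h N ⟨?_⟩ ?_ ?_ ?_
    · rintro _ ⟨a, ha, rfl⟩ g
      exact ⟨g * a * g⁻¹, hEN.conj_mem a ha g, conj_pow⟩
    · rintro _ ⟨a, ha, rfl⟩
      obtain ⟨k, hk, hk2⟩ := isOfFinOrder_iff_pow_eq_one.1 (hDp (π a) ha.1)
      rw [isOfFinOrder_iff_pow_eq_one]
      refine ⟨k, hk, ?_⟩
      rw [← pow_mul, mul_comm, pow_mul]
      refine hFm _ ?_
      rw [← map_pow] at hk2
      exact (QuotientGroup.eq_one_iff _).1 hk2
    · intro x y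
      exact Subtype.ext (hEab x (hNE x.2) y (hNE y.2))
    · rintro _ ⟨a, ha, rfl⟩ k hk
      obtain ⟨c, hc, f, hf, rfl⟩ := hdec a ha.1 k hk
      refine ⟨c ^ m, ⟨c, hc, rfl⟩, ?_⟩
      have : Commute (c ^ k) f := Commute.pow_left (hEF c hc f hf).symm k
      rw [this.mul_pow, hFm f hf, mul_one, ← pow_mul, ← pow_mul, mul_comm]
  rw [eq_bot_iff]
  intro d hd
  obtain ⟨d, rfl⟩ := QuotientGroup.mk'_surjective F d
  obtain ⟨c, hc, f, hf, hcf⟩ := hdec d hd m hmpos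
  have h1 : c ^ m ∈ N := ⟨c, hc, rfl⟩
  rw [hNbot, Subgroup.mem_bot] at h1
  rw [h1, one_mul] at hcf
  rw [Subgroup.mem_bot, hcf]
  exact (QuotientGroup.eq_one_iff f).2 hf

lemma PropKInf_quot {G : Type*} [Group G] (hG : PropKInf G) (F : Subgroup G) [F.Normal] :
    PropKInf (G ⧸ F) := by
  intro X
  let π := QuotientGroup.mk' F
  have hs : Function.Surjective π := QuotientGroup.mk'_surjective F
  refine ((hG (X.comap π)).image (Subgroup.map π)).subset ?_
  rintro _ ⟨H, hH, rfl⟩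
  refine ⟨⁅X.comap π, H.comap π⁆, ⟨H.comap π, ?_, rfl⟩, ?_⟩
  · refine Infinite.of_surjective (fun g : H.comap π => (⟨π g, g.2⟩ : H)) ?_
    rintro ⟨q, hq⟩
    obtain ⟨g, rfl⟩ := hs q
    exact ⟨⟨g, hq⟩, rfl⟩
  · rw [Subgroup.map_commutator, Subgroup.map_comap_eq_self_of_surjective hs,
      Subgroup.map_comap_eq_self_of_surjective hs]

lemma PropKInf_sub {G : Type*} [Group G] (hG : PropKInf G) (L : Subgroup G) : PropKInf L := by
  intro X
  refine Set.Finite.of_finite_image (f := Subgroup.map L.subtype)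
    ((hG (X.map L.subtype)).subset ?_) (Subgroup.map_injective L.subtype_injective).injOn
  rintro _ ⟨_, ⟨H, hH, rfl⟩, rfl⟩
  refine ⟨H.map L.subtype, ?_, Subgroup.map_commutator _ _ _⟩
  exact Infinite.of_injective _ (H.equivMapOfInjective L.subtype L.subtype_injective).injective

lemma finite_sSup' {G : Type*} [Group G] (A : Subgroup G)
    (hA : ∀ a ∈ A, ∀ b ∈ A, a * b = b * a) :
    ∀ 𝒮 : Set (Subgroup G), 𝒮.Finite → (∀ S ∈ 𝒮, S ≤ A ∧ (S : Set G).Finite) →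
        sSup 𝒮 ≤ A ∧ ((sSup 𝒮 : Subgroup G) : Set G).Finite := by
  intro 𝒮 hS
  induction 𝒮, hS using Set.Finite.induction_on with
  | empty => intro _; simp
  | insert _ _ ih =>
    intro h
    rw [sSup_insert]
    have i1 := ih fun S hS => h S (Set.mem_insert_of_mem _ hS)
    have i2 := h _ (Set.mem_insert _ _)
    exact ⟨sup_le i2.1 i1.1, finite_sup' A hA _ _ i2.1 i1.1 i2.2 i1.2⟩

lemma class2 {L : Type*} [Group L] (hK : PropKInf L)
    (hc : ⁅(⊤ : Subgroup L), (⊤ : Subgroup L)⁆ ≤ Subgroup.center L)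
    (hred : ∀ D : Subgroup L, Per D → Dvb D → D = ⊥) :
    ((⁅(⊤ : Subgroup L), (⊤ : Subgroup L)⁆ : Subgroup L) : Set L).Finite := by
  by_contra hinf
  have hZinf : (Subgroup.center L : Set L).Infinite := Set.Infinite.mono hc hinf
  let A : L → Subgroup L := fun x => Subgroup.zpowers x ⊔ Subgroup.center L
  have hAn : ∀ x, (A x).Normal := by
    intro x
    rw [← Subgroup.commutator_top_right_le_iff]
    exact (Subgroup.commutator_mono le_top le_rfl).trans (hc.trans le_sup_right)
  have hAc : ∀ x, ∀ a ∈ A x, ∀ b ∈ A x, a * b = b * a := by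
    intro x a ha b hb
    obtain ⟨_, ⟨i, rfl⟩, c, hc, rfl⟩ := Subgroup.mem_sup_of_normal_right.1 ha
    obtain ⟨_, ⟨j, rfl⟩, d, hd, rfl⟩ := Subgroup.mem_sup_of_normal_right.1 hb
    have h1 := Subgroup.mem_center_iff.1 hc
    have h2 := Subgroup.mem_center_iff.1 hd
    have h3 : Commute (x ^ i * c) (x ^ j * d) := by
      refine Commute.mul_left ?_ (h1 _).symm
      exact Commute.mul_right (Commute.zpow_zpow_self x i j) (h2 _)
    exact h3
  have hfin : ∀ x, ((⁅A x, (⊤ : Subgroup L)⁆ : Subgroup L) : Set L).Finite := by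
    intro x
    have := hAn x
    exact lemma3 hK (A x) (hAc x) (fun D _ h1 h2 => hred D h1 h2)
  have h1 : (Set.range fun x : L => ⁅A x, (⊤ : Subgroup L)⁆).Finite := by
    refine (hK ⊤).subset ?_
    rintro _ ⟨x, rfl⟩
    refine ⟨A x, ?_, Subgroup.commutator_comm _ _⟩
    exact (Set.Infinite.mono (le_sup_right : Subgroup.center L ≤ A x) hZinf).to_subtype
  have h2 := finite_sSup' (Subgroup.center L)
    (fun a ha b hb => (Subgroup.mem_center_iff.1 ha b).symm) _ h1 (by
      rintro _ ⟨x, rfl⟩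
      exact ⟨(Subgroup.commutator_mono le_top le_rfl).trans hc, hfin x⟩)
  apply hinf
  refine h2.2.subset ?_
  have : ⁅(⊤ : Subgroup L), (⊤ : Subgroup L)⁆ ≤ sSup (Set.range fun x : L => ⁅A x, (⊤ : Subgroup L)⁆) := by
    rw [Subgroup.commutator_le]
    intro a _ b _
    exact (le_sSup (Set.mem_range_self (f := fun x : L => ⁅A x, (⊤ : Subgroup L)⁆) a))
      (Subgroup.commutator_mem_commutator
        ((le_sup_left : Subgroup.zpowers a ≤ A a) (Subgroup.mem_zpowers a)) trivial)
  exact this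

lemma class2' {G : Type*} [Group G] (hK : PropKInf G) (hG : NoDiv G) (L : Subgroup G) [L.Normal]
    (hc : ⁅L, L⁆ ≤ Subgroup.center G) : ((⁅L, L⁆ : Subgroup G) : Set G).Finite := by
  have hmap : (⁅(⊤ : Subgroup L), (⊤ : Subgroup L)⁆).map L.subtype = ⁅L, L⁆ := by
    rw [Subgroup.map_commutator, ← MonoidHom.range_eq_map, L.range_subtype]
  have hmem : ∀ a b : L, ((⁅a, b⁆ : L) : G) ∈ Subgroup.center G := by
    intro a b
    apply hc
    rw [← hmap]
    exact ⟨⁅a, b⁆, Subgroup.commutator_mem_commutator trivial trivial, rfl⟩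
  have hcL : ⁅(⊤ : Subgroup L), (⊤ : Subgroup L)⁆ ≤ Subgroup.center L := by
    rw [Subgroup.commutator_le]
    intro a _ b _
    rw [Subgroup.mem_center_iff]
    intro g
    exact Subtype.ext (Subgroup.mem_center_iff.1 (hmem a b) g)
  rw [← hmap, Subgroup.coe_map]
  refine Set.Finite.image _ (class2 (PropKInf_sub hK L) hcL ?_)
  intro D hD1 hD2
  have hDZ : D ≤ Subgroup.center L := by
    intro d hd
    rw [Subgroup.mem_center_iff]
    intro l
    let f : L →* L :=
      { toFun := fun d => ⁅d, l⁆
        map_one' := by simp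
        map_mul' := by
          intro a b
          rw [commutatorElement_mul_left_eq_conj_mul]
          have := Subgroup.mem_center_iff.1 (hcL (Subgroup.commutator_mem_commutator
            (Subgroup.mem_top b) (Subgroup.mem_top l))) 
          rw [this a, mul_assoc, mul_assoc, mul_inv_cancel_left]
          exact (this _).symm }
    have h1 : (D.map f).map L.subtype = ⊥ := by
      refine hG.red (Subgroup.center G)
        (fun a ha b hb => (Subgroup.mem_center_iff.1 ha b).symm) _ ?_ ((hD1.map f).map _)
        ((hD2.map f).map _)
      rintro _ ⟨_, ⟨a, ha, rfl⟩, rfl⟩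
      exact hmem a l
    have h2 : L.subtype (f d) ∈ (D.map f).map L.subtype := ⟨_, ⟨d, hd, rfl⟩, rfl⟩
    rw [h1, Subgroup.mem_bot] at h2
    have h3 : ⁅d, l⁆ = 1 := Subtype.ext h2
    exact (commutatorElement_eq_one_iff_mul_comm.1 h3).symm
  have h1 : D.map L.subtype = ⊥ := by
    refine hG.red ((Subgroup.center L).map L.subtype) ?_ _ (Subgroup.map_mono hDZ)
      (hD1.map _) (hD2.map _)
    rintro _ ⟨a, ha, rfl⟩ _ ⟨b, hb, rfl⟩
    exact congrArg Subtype.val ((Subgroup.mem_center_iff.1 ha b).symm)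
  exact (Subgroup.map_eq_bot_iff_of_injective D L.subtype_injective).1 h1

lemma finite_of_map {G : Type*} [Group G] (F : Subgroup G) [F.Normal] (hF : (F : Set G).Finite)
    (S : Subgroup G) (hS : ((S.map (QuotientGroup.mk' F) : Subgroup (G ⧸ F)) : Set (G ⧸ F)).Finite) :
    (S : Set G).Finite := by
  refine Set.Finite.of_finite_fibers (QuotientGroup.mk' F) hS ?_
  rintro _ ⟨c, hc, rfl⟩
  refine (hF.image (fun f => c * f)).subset ?_
  rintro d ⟨hd, hd2⟩
  refine ⟨c⁻¹ * d, ?_, by simp⟩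
  have : QuotientGroup.mk' F d = QuotientGroup.mk' F c := hd2
  exact QuotientGroup.eq.1 this.symm

universe u

theorem main_aux (n : ℕ) : ∀ (G : Type u) [Group G], derivedSeries G n = ⊥ → NoDiv G → PropKInf G →
    ((commutator G : Subgroup G) : Set G).Finite := by
  induction n with
  | zero =>
    intro G _ h _ _
    have : commutator G = ⊥ := by
      rw [eq_bot_iff, ← h]; exact le_top
    rw [this]; exact Set.finite_singleton 1
  | succ n ih =>
    intro G _ h hN hK
    cases n with
    | zero =>
      rw [zero_add, derivedSeries_one] at h
      rw [h]; exact Set.finite_singleton 1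
    | succ n =>
      set A := derivedSeries G (n + 1) with hA
      have hAn : A.Normal := derivedSeries_normal G (n + 1)
      have hAc : ∀ a ∈ A, ∀ b ∈ A, a * b = b * a := by
        intro a ha b hb
        rw [derivedSeries_succ] at h
        have := Subgroup.commutator_mem_commutator ha hb
        rw [← hA] at h
        rw [h, Subgroup.mem_bot] at this
        exact commutatorElement_eq_one_iff_mul_comm.1 this
      let F := ⁅A, (⊤ : Subgroup G)⁆
      have hF : (F : Set G).Finite := lemma3 hK A hAc (fun D hD h1 h2 => hN.red A hAc D hD h1 h2)
      have hAfin : (A : Set G).Finite := by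
        refine finite_of_map F hF A ?_
        have hLn : (derivedSeries (G ⧸ F) n).Normal := derivedSeries_normal _ n
        have h1 : A.map (QuotientGroup.mk' F) = ⁅derivedSeries (G ⧸ F) n, derivedSeries (G ⧸ F) n⁆ := by
          exact (map_derivedSeries_eq (QuotientGroup.mk'_surjective F) (n + 1)).trans
            (derivedSeries_succ _ n)
        rw [h1]
        refine class2' (PropKInf_quot hK F) (hN.quot F hF) _ ?_
        rw [← h1, ← Subgroup.commutator_top_right_eq_bot_iff_le_center,
          ← Subgroup.map_top_of_surjective _ (QuotientGroup.mk'_surjective F),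
          ← Subgroup.map_commutator]
        exact QuotientGroup.map_mk'_self F
      refine finite_of_map A hAfin _ ?_
      have h2 : (commutator G).map (QuotientGroup.mk' A) = commutator (G ⧸ A) := by
        have := map_derivedSeries_eq (QuotientGroup.mk'_surjective A) 1
        rwa [derivedSeries_one, derivedSeries_one] at this
      rw [h2]
      refine ih (G ⧸ A) ?_ (hN.quot A hAfin) (PropKInf_quot hK A)
      rw [← map_derivedSeries_eq (QuotientGroup.mk'_surjective A)]
      exact QuotientGroup.map_mk'_self A
end
end KInf

theorem stmt_17 (G : Type*) [Group G] (hsol : IsSolvable G)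
    (hnd : ∀ N : Subgroup G, N.Normal →
      (∀ a ∈ N, IsOfFinOrder a) →
      (∀ x y : N, x * y = y * x) →
      (∀ a ∈ N, ∀ n : ℕ, 0 < n → ∃ b ∈ N, b ^ n = a) →
      N = ⊥)
    (hG : PropKInf G) : Finite (commutator G) := by
  obtain ⟨n, hn⟩ := hsol.solvable
  exact KInf.main_aux n G hn hnd hG
end
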